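/- arXiv:1312.0490 — 3 statements merged into one kernel-verified Lean document; each statement's English description precedes it below -/
import Mathlib

section
/- Let p be a prime, let q = p^r be a prime power, let F_q be the finite field with q elements, and let j, a be natural numbers. Then the set {x ∈ W_j(F_q) | p^a · x = 0} of elements of the ring of p-typical Witt vectors of length j over F_q killed by p^a has exactly q^{min(j, a)} elements. (This cardinality computation is the key step in the paper's proof that the numerical dimension is well-defined, Lemma 'nd is well-defined', where the kernel of conjugation on truncated Witt vectors over F_{q^s} is counted.) -/
theorem TruncatedWittVector.p_pow_mul_eq_zero_iff {p : ℕ} [Fact p.Prime] {R : Type*}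
    [CommRing R] [IsReduced R] [CharP R p] {n : ℕ} (a : ℕ) (x : TruncatedWittVector p n R) :
    (p : TruncatedWittVector p n R) ^ a * x = 0 ↔ ∀ i : Fin n, i + a < n → x.coeff i = 0 := by
  obtain ⟨y, rfl⟩ := WittVector.truncate_surjective p n R x
  have h : (p : TruncatedWittVector p n R) ^ a * WittVector.truncate n y =
      WittVector.truncate n (y * (p : WittVector p R) ^ a) := by
    rw [mul_comm, map_mul, map_pow, map_natCast]
  rw [h, ← RingHom.mem_ker, WittVector.mem_ker_truncate]
  simp only [WittVector.coeff_truncate]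
  constructor
  · intro H i hi
    have := H _ hi
    rw [WittVector.mul_pow_charP_coeff_succ] at this
    exact eq_zero_of_pow_eq_zero this
  · intro H m hm
    obtain hma | hma := lt_or_ge m a
    · exact WittVector.mul_pow_charP_coeff_zero y hma
    · obtain ⟨k, rfl⟩ := Nat.exists_eq_add_of_le' hma
      rw [WittVector.mul_pow_charP_coeff_succ, H ⟨k, by omega⟩ hm,
        zero_pow (pow_ne_zero _ (Fact.out : p.Prime).ne_zero)]

theorem Fin.card_subtype_not_add_lt (n a : ℕ) :
    Nat.card {i : Fin n // ¬ (i : ℕ) + a < n} = min n a := by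
  let e : {i : Fin n // ¬ (i : ℕ) + a < n} ≃ Fin (min n a) :=
    { toFun i := ⟨n - 1 - i.1, by have := i.1.2; have := i.2; omega⟩
      invFun k := ⟨⟨n - 1 - k, by have := k.2; omega⟩, by have := k.2; simp only; omega⟩
      left_inv i := by ext; simp only; have := i.1.2; omega
      right_inv k := by ext; simp only; have := k.2; omega }
  rw [Nat.card_congr e, Nat.card_fin]


/-- Let `q = p^r` be a prime power and `K` the finite field with `q` elements. The set of
elements of the length-`j` truncated `p`-typical Witt vectors over `K` killed by `p^a`
has exactly `q ^ min j a` elements. -/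
theorem card_truncatedWittVector_killed_by_pow_p
    (p r : ℕ) [Fact p.Prime] (hr : 1 ≤ r) (q : ℕ) (hq : q = p ^ r)
    (K : Type*) [Field K] [Fintype K] [CharP K p] (hK : Fintype.card K = q)
    (j a : ℕ) :
    Nat.card {x : TruncatedWittVector p j K //
        (p : TruncatedWittVector p j K) ^ a * x = 0} = q ^ min j a := by
  let e : {x : TruncatedWittVector p j K // (p : TruncatedWittVector p j K) ^ a * x = 0} ≃
      ({i : Fin j // ¬ (i : ℕ) + a < j} → K) :=
    (Equiv.subtypeEquivRight fun x => by
      rw [TruncatedWittVector.p_pow_mul_eq_zero_iff, funext_iff, Subtype.forall]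
      rfl).trans (Equiv.subtypePreimage (fun i : Fin j => (i : ℕ) + a < j) fun _ => (0 : K))
  rw [Nat.card_congr e, Nat.card_fun, Fin.card_subtype_not_add_lt, Nat.card_eq_fintype_card, hK]
end

section
/- Let F_q be a finite field with q elements and let A be a nonzero finitely generated F_q-algebra such that A ⊗_{F_q} F̄_q is an integral domain (i.e. Spec A is geometrically integral over F_q), and let d be the Krull dimension of A. Then for every finite field extension K of F_q the set of F_q-algebra homomorphisms A → K is finite, and there exist real constants C₁, C₂ > 0 and an integer N such that for every n ≥ N and every field extension K of F_q of degree n one has C₁ · q^{n·d} ≤ #Hom_{F_q-alg}(A, K) ≤ C₂ · q^{n·d}. (This is the affine, geometrically integral case of the paper's Proposition deduced from the theorem of Lang and Weil: the number of F_{q^n}-points of a variety of dimension d over F_q grows like q^{n·d}.) -/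
namespace LangWeil

open MvPolynomial

section Box

variable {σ k C : Type} [Field k] [CommRing C] [Algebra (MvPolynomial σ k) C] {D : ℕ}
  (B : Module.Basis (Fin D) (MvPolynomial σ k) C)

/-- The elements of `C` all of whose coordinates have degree at most `m` in each variable. -/
def Box (m : ℕ) (h : C) : Prop := ∀ i j, degreeOf j (B.repr h i) ≤ m

/-- The exponent vector attached to a point of a box. -/
noncomputable def expo [Finite σ] {m : ℕ} (a : σ → Fin m) : σ →₀ ℕ :=
  Finsupp.equivFunOnFinite.symm fun j => (a j : ℕ)

/-- The monomial `x ^ a * B i`. -/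
noncomputable def mon [Finite σ] {m : ℕ} (α : Fin D × (σ → Fin m)) : C :=
  monomial (expo α.2) (1 : k) • B α.1

variable {B}

lemma Box.mono {m n : ℕ} {h : C} (hh : Box B m h) (hmn : m ≤ n) : Box B n h :=
  fun i j => (hh i j).trans hmn

lemma Box.sum {ι : Type} {m : ℕ} {s : Finset ι} {h : ι → C} (hh : ∀ i ∈ s, Box B m (h i)) :
    Box B m (∑ i ∈ s, h i) := by
  intro i j
  rw [map_sum, Finsupp.finsetSum_apply]
  exact (degreeOf_sum_le _ _ _).trans (Finset.sup_le fun l hl => hh l hl i j)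

lemma Box.sub {m : ℕ} {g h : C} (hg : Box B m g) (hh : Box B m h) : Box B m (g - h) := by
  intro i j
  rw [map_sub, Finsupp.sub_apply]
  exact (degreeOf_sub_le _ _ _).trans (max_le (hg i j) (hh i j))

lemma Box.smul {m n : ℕ} {r : MvPolynomial σ k} (hr : ∀ j, degreeOf j r ≤ m) {h : C}
    (hh : Box B n h) : Box B (m + n) (r • h) := by
  intro i j
  rw [map_smul, Finsupp.smul_apply, smul_eq_mul]
  exact (degreeOf_mul_le _ _ _).trans (add_le_add (hr j) (hh i j))

lemma Box.C_smul {n : ℕ} (c : k) {h : C} (hh : Box B n h) :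
    Box B n ((MvPolynomial.C c : MvPolynomial σ k) • h) := by
  simpa using Box.smul (m := 0) (fun j => by simp) hh

lemma exists_forall_degreeOf_le [Finite σ] (r : MvPolynomial σ k) :
    ∃ m, ∀ j, degreeOf j r ≤ m :=
  ⟨r.totalDegree, fun j => degreeOf_le_totalDegree r j⟩

variable (B) in
lemma Box.exists [Finite σ] (h : C) : ∃ m, Box B m h :=
  ⟨Finset.univ.sup fun i => (B.repr h i).totalDegree, fun i j =>
    (degreeOf_le_totalDegree _ j).trans
      (Finset.le_sup (f := fun i => (B.repr h i).totalDegree) (Finset.mem_univ i))⟩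

variable (B) in
lemma Box.exists_forall [Finite σ] {ι : Type} [Fintype ι] (h : ι → C) :
    ∃ m, ∀ i, Box B m (h i) := by
  choose m hm using fun i => Box.exists B (h i)
  exact ⟨Finset.univ.sup m, fun i => (hm i).mono (Finset.le_sup (Finset.mem_univ i))⟩

variable (B) in
/-- Multiplication adds box sizes up to a bounded error. -/
lemma Box.exists_mul [Finite σ] :
    ∃ w, ∀ m n u v, Box B m u → Box B n v → Box B (m + n + w) (u * v) := by
  obtain ⟨w, hw⟩ := Box.exists_forall B fun ij : Fin D × Fin D => B ij.1 * B ij.2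
  refine ⟨w, fun m n u v hu hv => ?_⟩
  rw [← B.sum_repr u, ← B.sum_repr v, Finset.sum_mul_sum]
  refine Box.sum fun i _ => Box.sum fun j _ => ?_
  rw [smul_mul_smul_comm]
  exact Box.smul (fun l => (degreeOf_mul_le _ _ _).trans (add_le_add (hu i l) (hv j l)))
    (hw (i, j))

lemma Box.pow {w : ℕ}
    (hw : ∀ m n u v, Box B m u → Box B n v → Box B (m + n + w) (u * v)) {m : ℕ} {u : C}
    (hu : Box B m u) {n : ℕ} (hn : 0 < n) : Box B (n * (m + w)) (u ^ n) := by
  induction n, hn using Nat.le_induction with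
  | base => simpa using hu.mono (Nat.le_add_right m w)
  | succ n hn ih =>
    rw [pow_succ]
    exact (hw _ _ _ _ ih hu).mono (by ring_nf; rfl)

lemma repr_mon [Finite σ] {m : ℕ} (α : Fin D × (σ → Fin m)) :
    B.repr (mon B α) = Finsupp.single α.1 (monomial (expo α.2) 1) := by
  rw [mon, map_smul, B.repr_self, Finsupp.smul_single, smul_eq_mul, mul_one]

lemma box_mon [Finite σ] {m : ℕ} (α : Fin D × (σ → Fin (m + 1))) : Box B m (mon B α) := by
  intro i j
  rw [repr_mon, Finsupp.single_apply]
  split_ifs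
  · rw [degreeOf_monomial_eq _ _ one_ne_zero]
    simpa [expo] using Nat.lt_succ_iff.mp (α.2 j).2
  · simp

lemma expo_injective [Finite σ] {m : ℕ} : Function.Injective (expo (σ := σ) (m := m)) := by
  intro a b h
  ext j
  simpa [expo] using DFunLike.congr_fun h j

lemma coeff_repr_sum_mon [Fintype σ] [DecidableEq σ] {m : ℕ} (c : Fin D × (σ → Fin m) → k)
    (i : Fin D) (t : σ → Fin m) :
    coeff (expo t) (B.repr (∑ α, (MvPolynomial.C (c α) : MvPolynomial σ k) • mon B α) i)
      = c (i, t) := by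
  classical
  rw [map_sum, Finsupp.finsetSum_apply, coeff_sum, Finset.sum_eq_single (i, t)]
  · simp [repr_mon]
  · intro α _ hα
    rw [map_smul, repr_mon, Finsupp.smul_apply, smul_eq_mul, coeff_C_mul, Finsupp.single_apply]
    split_ifs with h
    · rw [coeff_monomial, if_neg, mul_zero]
      intro h'
      exact hα (Prod.ext h (expo_injective h'))
    · simp
  · simp

lemma sum_mon_ne_zero [Fintype σ] [DecidableEq σ] {m : ℕ} {c : Fin D × (σ → Fin m) → k}
    (hc : c ≠ 0) :
    ∑ α, (MvPolynomial.C (c α) : MvPolynomial σ k) • mon B α ≠ 0 := by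
  intro h
  apply hc
  ext α
  rw [← coeff_repr_sum_mon (B := B) c α.1 α.2, h]
  simp

lemma Box.eq_zero [Finite σ] {m : ℕ} {h : C} (hh : Box B m h)
    (h0 : ∀ i (t : σ → Fin (m + 1)), coeff (expo t) (B.repr h i) = 0) : h = 0 := by
  apply B.repr.injective
  rw [map_zero]
  ext i s
  rw [Finsupp.zero_apply, coeff_zero]
  by_contra hs
  have hs' : ∀ j, s j < m + 1 := fun j => Nat.lt_succ_iff.mpr
    (degreeOf_le_iff.mp (hh i j) s (mem_support_iff.mpr hs))
  apply hs
  have := h0 i fun j => ⟨s j, hs' j⟩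
  rwa [show expo (fun j => ⟨s j, hs' j⟩ : σ → Fin (m + 1)) = s by ext j; simp [expo]] at this

end Box

/-- `C` is the coordinate ring of the hypersurface `f = 0`, with `y` the class of the last
coordinate and `B` its power basis over the polynomial ring; over the locus `Δ ≠ 0` the
projection to affine space is étale. -/
structure IsHypersurface {σ k C : Type} [Field k] [CommRing C] [Algebra (MvPolynomial σ k) C]
    {D : ℕ} (B : Module.Basis (Fin D) (MvPolynomial σ k) C) (y : C)
    (f : Polynomial (MvPolynomial σ k)) (Δ : MvPolynomial σ k) : Prop where
  isDomain : IsDomain C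
  basis_eq : ∀ i, B i = y ^ (i : ℕ)
  monic : f.Monic
  natDegree_eq : f.natDegree = D
  root : Polynomial.aeval y f = 0
  lift : ∀ (S : Type) [CommRing S] (g : MvPolynomial σ k →+* S) (b : S),
    f.eval₂ g b = 0 → ∃ e : C →+* S, (∀ r, e (algebraMap _ _ r) = g r) ∧ e y = b
  ne_zero : Δ ≠ 0
  separable : ∀ a, eval a Δ ≠ 0 → (f.map (eval a)).Separable

section Norm

variable {σ k C : Type} [Field k] [CommRing C] [Algebra (MvPolynomial σ k) C] {D : ℕ}
  {B : Module.Basis (Fin D) (MvPolynomial σ k) C}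

lemma totalDegree_le_of_degreeOf_le [Fintype σ] {r : MvPolynomial σ k} {m : ℕ}
    (hr : ∀ j, degreeOf j r ≤ m) : r.totalDegree ≤ Fintype.card σ * m := by
  rw [totalDegree, Finset.sup_le_iff]
  intro s hs
  rw [Finsupp.sum_fintype _ _ (fun _ => rfl)]
  exact (Finset.sum_le_sum fun j _ => degreeOf_le_iff.mp (hr j) s hs).trans (by simp)

lemma totalDegree_det_le (M : Matrix (Fin D) (Fin D) (MvPolynomial σ k)) {t : ℕ}
    (hM : ∀ i j, (M i j).totalDegree ≤ t) : M.det.totalDegree ≤ D * t := by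
  rw [Matrix.det_apply]
  refine totalDegree_finsetSum_le fun τ _ => ?_
  have h : (∏ i, M (τ i) i).totalDegree ≤ D * t :=
    (totalDegree_finsetProd _ _).trans
      ((Finset.sum_le_sum fun i _ => hM (τ i) i).trans (by simp))
  rcases Int.units_eq_one_or (Equiv.Perm.sign τ) with h1 | h1 <;> rw [h1]
  · simpa using h
  · rw [Units.neg_smul, one_smul, totalDegree_neg]
    exact h

variable (B) in
/-- Norms of elements of a box have bounded degree. -/
lemma exists_totalDegree_norm_le [Fintype σ] (L : ℕ) :
    ∃ N, ∀ h, Box B L h → (Algebra.norm (MvPolynomial σ k) h).totalDegree ≤ N := by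
  obtain ⟨w, hw⟩ := Box.exists_mul B
  obtain ⟨m, hm⟩ := Box.exists_forall B B
  refine ⟨D * (Fintype.card σ * (L + m + w)), fun h hh => ?_⟩
  rw [Algebra.norm_eq_matrix_det B]
  refine totalDegree_det_le _ fun i j => totalDegree_le_of_degreeOf_le fun l => ?_
  rw [Algebra.leftMulMatrix_eq_repr_mul]
  exact hw _ _ _ _ hh (hm j) i l

lemma dvd_algebraMap_norm (B : Module.Basis (Fin D) (MvPolynomial σ k) C) (h : C) :
    h ∣ algebraMap (MvPolynomial σ k) C (Algebra.norm (MvPolynomial σ k) h) := by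
  set M := Algebra.leftMulMatrix B h with hM
  have h0 : Polynomial.aeval h M.charpoly = 0 := by
    apply Algebra.leftMulMatrix_injective B
    rw [← Polynomial.aeval_algHom_apply, map_zero]
    exact M.aeval_self_charpoly
  rw [← M.charpoly.divX_mul_X_add, map_add, map_mul, Polynomial.aeval_X, Polynomial.aeval_C] at h0
  rw [Algebra.norm_eq_matrix_det B, M.det_eq_sign_charpoly_coeff, map_mul]
  exact Dvd.dvd.mul_left ⟨-Polynomial.aeval h M.charpoly.divX, by linear_combination h0⟩ _

lemma ringHom_ext_of_basis {y : C} (hB : ∀ i, B i = y ^ (i : ℕ)) {S : Type} [CommRing S]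
    {e e' : C →+* S} (hr : ∀ r, e (algebraMap (MvPolynomial σ k) C r) = e' (algebraMap _ C r))
    (hy : e y = e' y) : e = e' := by
  ext z
  rw [← B.sum_repr z]
  simp only [Algebra.smul_def, map_sum, map_mul, hr, hB, map_pow, hy]

end Norm

section Truncated

/-- Truncated power series `k[T] / (T ^ n)`, with their reduction modulo `T`. -/
lemma exists_truncated (k : Type) [Field k] {n : ℕ} (hn : 0 < n) :
    ∃ (S : Type) (_ : CommRing S) (_ : Algebra k S) (g : Polynomial k →ₐ[k] S) (π : S →ₐ[k] k),
      (∀ s, π s = 0 → s ^ n = 0) ∧ (∀ P, g P = 0 → Polynomial.X ^ n ∣ P) ∧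
        ∀ P, π (g P) = P.eval 0 := by
  have h : (0 : k) ^ n = 0 := zero_pow hn.ne'
  refine ⟨AdjoinRoot (Polynomial.X ^ n : Polynomial k), inferInstance, inferInstance,
    AdjoinRoot.mkₐ _,
    AdjoinRoot.liftAlgHom _ (AlgHom.id k k) 0 (by simp [h]), ?_, ?_, ?_⟩
  · intro s
    induction s using AdjoinRoot.induction_on with
    | ih P =>
      intro hP
      rw [AdjoinRoot.liftAlgHom_mk] at hP
      have : Polynomial.X ∣ P := by
        rw [Polynomial.X_dvd_iff, Polynomial.coeff_zero_eq_eval_zero]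
        simpa [Polynomial.eval₂_eq_eval_map] using hP
      rw [← map_pow, AdjoinRoot.mk_eq_zero]
      exact pow_dvd_pow_of_dvd this n
  · intro P hP
    exact AdjoinRoot.mk_eq_zero.mp hP
  · intro P
    rw [AdjoinRoot.coe_mkₐ, AdjoinRoot.liftAlgHom_mk]
    simp [Polynomial.eval₂_eq_eval_map]

end Truncated

section Nonvanishing

variable {σ k C : Type} [Field k] [CommRing C] [Algebra (MvPolynomial σ k) C] {D : ℕ}
  {B : Module.Basis (Fin D) (MvPolynomial σ k) C} {y : C}
  {f : Polynomial (MvPolynomial σ k)} {Δ : MvPolynomial σ k}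

lemma IsHypersurface.pos (H : IsHypersurface B y f Δ) : 0 < D := by
  have := H.isDomain
  exact Fin.pos_iff_nonempty.mpr B.index_nonempty

lemma IsHypersurface.exists_root [IsAlgClosed k] (H : IsHypersurface B y f Δ) (a : σ → k) :
    ∃ b, (f.map (eval a)).eval b = 0 := by
  refine IsAlgClosed.exists_root _ ?_
  rw [H.monic.degree_map, Polynomial.degree_eq_natDegree H.monic.ne_zero, H.natDegree_eq]
  exact_mod_cast H.pos.ne'

lemma IsHypersurface.exists_point (H : IsHypersurface B y f Δ) {a : σ → k} {b : k}
    (hb : (f.map (eval a)).eval b = 0) :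
    ∃ e : C →+* k, (∀ r, e (algebraMap _ _ r) = eval a r) ∧ e y = b :=
  H.lift k (eval a) b (by rwa [Polynomial.eval₂_eq_eval_map])

/-- Points of an étale cover lift along nilpotent thickenings. -/
lemma IsHypersurface.exists_lift (H : IsHypersurface B y f Δ) {a : σ → k} (ha : eval a Δ ≠ 0)
    {e₀ : C →+* k} (he₀ : ∀ r, e₀ (algebraMap _ _ r) = eval a r)
    {S : Type} [CommRing S] [Algebra k S] {n : ℕ} (π : S →ₐ[k] k)
    (hπ : ∀ s, π s = 0 → s ^ n = 0) (φ : MvPolynomial σ k →+* S)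
    (hφ : ∀ r, π (φ r) = eval a r) :
    ∃ e : C →+* S, (∀ r, e (algebraMap _ _ r) = φ r) ∧ ∀ z, π (e z) = e₀ z := by
  have hφ' : (π : S →+* k).comp φ = eval a := RingHom.ext hφ
  have hroot : (f.map (eval a)).eval (e₀ y) = 0 := by
    have := congrArg e₀ H.root
    rw [Polynomial.aeval_def, Polynomial.hom_eval₂, map_zero,
      show e₀.comp (algebraMap _ C) = eval a from RingHom.ext he₀] at this
    rwa [Polynomial.eval_map]
  have key (P : Polynomial (MvPolynomial σ k)) (s : S) :
      π ((P.map φ).eval s) = (P.map (eval a)).eval (π s) := by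
    rw [← hφ', ← Polynomial.map_map, ← RingHom.coe_coe π, Polynomial.eval_map_apply]
  have hnil : IsNilpotent (Polynomial.aeval (algebraMap k S (e₀ y)) (f.map φ)) := by
    refine ⟨n, hπ _ ?_⟩
    rw [Polynomial.coe_aeval_eq_eval, key, AlgHom.commutes]
    exact hroot
  have hunit : IsUnit (Polynomial.aeval (algebraMap k S (e₀ y)) (f.map φ).derivative) := by
    rw [Polynomial.coe_aeval_eq_eval, Polynomial.derivative_map]
    set s := (f.derivative.map φ).eval (algebraMap k S (e₀ y)) with hs
    have h1 : π s ≠ 0 := by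
      rw [hs, key, AlgHom.commutes, ← Polynomial.derivative_map]
      exact (H.separable a ha).eval₂_derivative_ne_zero (RingHom.id k) hroot
    have h2 : IsNilpotent (s - algebraMap k S (π s)) := ⟨n, hπ _ (by simp)⟩
    have h3 := h2.isUnit_add_left_of_commute ((IsUnit.mk0 _ h1).map (algebraMap k S))
      (Commute.all _ _)
    simpa using h3
  obtain ⟨r, ⟨hr, hr0⟩, -⟩ := Polynomial.existsUnique_nilpotent_sub_and_aeval_eq_zero hnil hunit
  obtain ⟨e, he, hey⟩ := H.lift S φ r (by
    rwa [Polynomial.eval₂_eq_eval_map, ← Polynomial.coe_aeval_eq_eval])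
  refine ⟨e, he, fun z => ?_⟩
  refine DFunLike.congr_fun (f := (π : S →+* k).comp e) (g := e₀)
    (ringHom_ext_of_basis (B := B) H.basis_eq (fun r => ?_) ?_) z
  · simp [he, hφ, he₀]
  · have := (hr.map (π : S →+* k)).eq_zero
    rw [map_sub] at this
    simpa [hey] using (sub_eq_zero.mp this).symm

lemma exists_eval_ne_zero [Infinite k] {r : MvPolynomial σ k} (hr : r ≠ 0) :
    ∃ a, eval a r ≠ 0 := by
  by_contra! h
  exact hr (MvPolynomial.funext fun a => by rw [h, map_zero])

variable (B) in
/-- Small-degree combinations of large Frobenius powers vanish only trivially. -/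
lemma IsHypersurface.nonvanishing [Fintype σ] [DecidableEq σ] [IsAlgClosed k] (p : ℕ)
    [Fact p.Prime] [CharP k p] (H : IsHypersurface B y f Δ) (L : ℕ) :
    ∃ N, ∀ κ, N < p ^ κ → ∀ g : Fin D × (σ → Fin (L + 1)) → C,
      (∑ α, mon B α * g α ^ p ^ κ) = 0 → g = 0 := by
  have := H.isDomain
  have : CharP C p := by
    have := charP_of_injective_algebraMap (R := k) (A := MvPolynomial σ k)
      (MvPolynomial.C_injective σ k) p
    exact charP_of_injective_algebraMap (R := MvPolynomial σ k) (B.algebraMap_injective) p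
  obtain ⟨N, hN⟩ := exists_totalDegree_norm_le B L
  refine ⟨N, fun κ hκ g hg => ?_⟩
  by_contra hg0
  obtain ⟨α₁, hα₁⟩ := Function.ne_iff.mp hg0
  have hn1 : Algebra.norm (MvPolynomial σ k) (g α₁) ≠ 0 := by
    rwa [Ne, Algebra.norm_eq_zero_iff_of_basis B]
  obtain ⟨a, ha⟩ := exists_eval_ne_zero (mul_ne_zero H.ne_zero hn1)
  rw [map_mul] at ha
  obtain ⟨b, hb⟩ := H.exists_root a
  obtain ⟨e₀, he₀, -⟩ := H.exists_point hb
  have hgα : e₀ (g α₁) ≠ 0 := by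
    intro h0
    have := map_dvd e₀ (dvd_algebraMap_norm B (g α₁))
    rw [h0, zero_dvd_iff, he₀] at this
    exact right_ne_zero_of_mul ha this
  set c : Fin D × (σ → Fin (L + 1)) → k := fun α => e₀ (g α) ^ p ^ κ with hc
  have hc0 : c ≠ 0 := fun h => pow_ne_zero (p ^ κ) hgα (congrFun h α₁)
  set h := ∑ α, (MvPolynomial.C (c α) : MvPolynomial σ k) • mon B α with hh
  have hbox : Box B L h := Box.sum fun α _ => (box_mon α).C_smul _
  have hn : Algebra.norm (MvPolynomial σ k) h ≠ 0 := by
    rw [Ne, Algebra.norm_eq_zero_iff_of_basis B]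
    exact sum_mon_ne_zero hc0
  obtain ⟨u, hu⟩ := exists_eval_ne_zero hn
  obtain ⟨S, _, _, G, π, hπ, hG, hπG⟩ := exists_truncated k (Nat.zero_lt_of_lt hκ)
  set φ : MvPolynomial σ k →ₐ[k] Polynomial k :=
    aeval fun j => Polynomial.C (a j) + Polynomial.C (u j - a j) * Polynomial.X with hφ
  have hφeval (t : k) (r : MvPolynomial σ k) :
      (φ r).eval t = eval (fun j => a j + (u j - a j) * t) r := by
    rw [hφ, ← Polynomial.coe_aeval_eq_eval, comp_aeval_apply,
      MvPolynomial.aeval_eq_eval]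
    congr 2
    ext j
    simp
  obtain ⟨e, he, hπe⟩ := H.exists_lift (left_ne_zero_of_mul ha) he₀ π hπ
    ((G : Polynomial k →+* S).comp (φ : MvPolynomial σ k →+* Polynomial k))
    (fun r => by simp [hπG, hφeval])
  have : Nontrivial S := π.toRingHom.domain_nontrivial
  have : CharP S p := charP_of_injective_algebraMap (algebraMap k S).injective p
  have hfrob (z : C) : e z ^ p ^ κ = algebraMap k S (e₀ z ^ p ^ κ) := by
    rw [map_pow, ← sub_eq_zero, ← sub_pow_char_pow]
    exact hπ _ (by simp [hπe])
  have heh : e h = 0 := by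
    rw [← map_zero e, ← hg, hh, map_sum, map_sum]
    refine Finset.sum_congr rfl fun α _ => ?_
    rw [Algebra.smul_def, map_mul, map_mul, map_pow e, hfrob, he, mul_comm]
    have hGC (x : k) : G (Polynomial.C x) = algebraMap k S x := G.commutes x
    simp [hφ, hc, hGC]
  have hdvd : Polynomial.X ^ p ^ κ ∣ φ (Algebra.norm (MvPolynomial σ k) h) := by
    apply hG
    have := map_dvd e (dvd_algebraMap_norm B h)
    rwa [heh, zero_dvd_iff, he] at this
  have hne : φ (Algebra.norm (MvPolynomial σ k) h) ≠ 0 := by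
    intro h0
    have := hφeval 1 (Algebra.norm (MvPolynomial σ k) h)
    rw [h0] at this
    simp at this
    exact hu this.symm
  have h1 := Polynomial.natDegree_le_of_dvd hdvd hne
  rw [Polynomial.natDegree_X_pow] at h1
  have h2 := MvPolynomial.aeval_natDegree_le (m := N) (n := 1) _ (hN h hbox)
    (fun j => Polynomial.C (a j) + Polynomial.C (u j - a j) * Polynomial.X)
    (fun j => by compute_degree)
  rw [← hφ] at h2
  omega

end Nonvanishing

section Auxiliary

lemma bernoulli_bound {D d w X q₀ : ℕ} (hD : 0 < D) (hX : 2 * d * w * D < X)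
    (hq : 2 * d * D < q₀) :
    (D - 1) * (q₀ * (X + w)) ^ d < D * (X * (q₀ - 1)) ^ d := by
  have hq1 : 1 ≤ q₀ := by omega
  have hX0 : 0 < X := by omega
  suffices h : ((D : ℝ) - 1) * (q₀ * (X + w)) ^ d < D * (X * (q₀ - 1)) ^ d by
    have h1 : (((D - 1) * (q₀ * (X + w)) ^ d : ℕ) : ℝ) < ((D * (X * (q₀ - 1)) ^ d : ℕ) : ℝ) := by
      push_cast [Nat.cast_sub hD, Nat.cast_sub hq1]
      exact h
    exact_mod_cast h1
  have hD' : (0 : ℝ) < D := by exact_mod_cast hD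
  have hq' : (0 : ℝ) < q₀ := by exact_mod_cast hq1
  have hX' : (0 : ℝ) < X := by exact_mod_cast hX0
  have hXr : (2 * d * w * D : ℝ) < X := by exact_mod_cast hX
  have hqr : (2 * d * D : ℝ) < q₀ := by exact_mod_cast hq
  have hXw : (0 : ℝ) < X + w := by positivity
  set r : ℝ := X * (q₀ - 1) / (q₀ * (X + w)) with hr
  have hw0 : (w : ℝ) / (X + w) ≤ 1 := by
    rw [div_le_one hXw]; linarith
  have hq0 : 1 / (q₀ : ℝ) ≤ 1 := by
    rw [div_le_one hq']; exact_mod_cast hq1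
  have hr1 : 1 - w / (X + w) - 1 / q₀ ≤ r := by
    have : r = 1 - w / (X + w) - 1 / q₀ + w / (X + w) * (1 / q₀) := by
      rw [hr]; field_simp; ring
    rw [this]
    have : (0 : ℝ) ≤ w / (X + w) * (1 / q₀) := by positivity
    linarith
  have hb := one_add_mul_le_pow (a := r - 1) (by linarith) d
  rw [add_sub_cancel] at hb
  have h1 : (d : ℝ) * (w / (X + w)) < 1 / (2 * D) := by
    rw [mul_div_assoc', div_lt_div_iff₀ hXw (by positivity)]
    nlinarith
  have h2 : (d : ℝ) * (1 / q₀) < 1 / (2 * D) := by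
    rw [mul_one_div, div_lt_div_iff₀ hq' (by positivity)]
    nlinarith
  have h3 : 1 - 1 / D < r ^ d := by
    have h4 : (d : ℝ) * (1 - w / (X + w) - 1 / q₀) ≤ d * r := by gcongr
    have h5 : (1 : ℝ) / D = 1 / (2 * D) + 1 / (2 * D) := by field_simp; ring
    linarith
  have h6 : (X * (q₀ - 1) : ℝ) = r * (q₀ * (X + w)) := by rw [hr]; field_simp
  rw [h6, mul_pow r, ← mul_assoc]
  have h7 : (D : ℝ) - 1 < D * r ^ d := by
    have := mul_lt_mul_of_pos_left h3 hD'
    rwa [mul_sub, mul_one, mul_one_div_cancel hD'.ne'] at this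
  exact mul_lt_mul_of_pos_right h7 (by positivity)

variable {σ k C : Type} [Field k] [CommRing C] [Algebra (MvPolynomial σ k) C] {D : ℕ}
  {B : Module.Basis (Fin D) (MvPolynomial σ k) C} {y : C}
  {f : Polynomial (MvPolynomial σ k)} {Δ : MvPolynomial σ k}

/-- The cofactor of `Y - y` in `f`. -/
lemma IsHypersurface.exists_cofactor (H : IsHypersurface B y f Δ) :
    ∃ G : Fin D → C, G ⟨D - 1, Nat.sub_lt H.pos one_pos⟩ = 1 ∧
      (∑ l, Polynomial.C (G l) * Polynomial.X ^ (l : ℕ)) * (Polynomial.X - Polynomial.C y) =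
        f.map (algebraMap _ C) := by
  have := H.isDomain
  have hroot : (f.map (algebraMap _ C)).IsRoot y := by
    rw [Polynomial.IsRoot, Polynomial.eval_map_algebraMap, H.root]
  have hmul := Polynomial.mul_divByMonic_eq_iff_isRoot.mpr hroot
  set g := f.map (algebraMap _ C) /ₘ (Polynomial.X - Polynomial.C y) with hg
  have hmon : g.Monic := by
    refine (Polynomial.monic_X_sub_C y).of_mul_monic_left ?_
    rw [hmul]
    exact H.monic.map _
  have hdeg : g.natDegree = D - 1 := by
    rw [hg, Polynomial.natDegree_divByMonic _ (Polynomial.monic_X_sub_C y),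
      H.monic.natDegree_map, H.natDegree_eq, Polynomial.natDegree_X_sub_C]
  refine ⟨fun l => g.coeff l, ?_, ?_⟩
  · change g.coeff (D - 1) = 1
    rw [← hdeg]
    exact hmon
  · rw [← hmul, mul_comm]
    congr 1
    rw [Fin.sum_univ_eq_sum_range (fun l => Polynomial.C (g.coeff l) * Polynomial.X ^ l) D]
    exact (g.as_sum_range_C_mul_X_pow' (by have := H.pos; omega)).symm

/-- Siegel-type lemma: a nontrivial solution of the system `H l = H (D - 1) * G l`. -/
lemma exists_siegel [Fintype σ] [DecidableEq σ] {w w₂ : ℕ}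
    (hw : ∀ m n u v, Box B m u → Box B n v → Box B (m + n + w) (u * v))
    {G : Fin D → C} (hG : ∀ l, Box B w₂ (G l)) (l₀ : Fin D) (hl₀ : G l₀ = 1)
    {L m P M : ℕ} (hP : 0 < P) (hM : P * (L + w) + m + w₂ + w ≤ M)
    (hlt : (D - 1) * (D * (M + 1) ^ Fintype.card σ) <
      D * (L + 1) ^ Fintype.card σ * (D * (m + 1) ^ Fintype.card σ)) :
    ∃ c : (Fin D × (σ → Fin (L + 1))) × (Fin D × (σ → Fin (m + 1))) → k, c ≠ 0 ∧
      ∀ l, (∑ α, ∑ t, (MvPolynomial.C (c (α, (l, t))) : MvPolynomial σ k) •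
          monomial (expo t) (1 : k) • mon B α ^ P) =
        (∑ α, ∑ t, (MvPolynomial.C (c (α, (l₀, t))) : MvPolynomial σ k) •
          monomial (expo t) (1 : k) • mon B α ^ P) * G l := by
  classical
  set V : ((Fin D × (σ → Fin (L + 1))) × (Fin D × (σ → Fin (m + 1))) → k) → Fin D → C :=
    fun c l => ∑ α, ∑ t, (MvPolynomial.C (c (α, (l, t))) : MvPolynomial σ k) •
      monomial (expo t) (1 : k) • mon B α ^ P with hV
  have hVbox (c) (l) : Box B (P * (L + w) + m) (V c l) := by
    refine Box.sum fun α _ => Box.sum fun t _ => Box.C_smul _ ?_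
    rw [add_comm]
    refine Box.smul (fun j => ?_) (Box.pow hw (box_mon α) hP)
    rw [degreeOf_monomial_eq _ _ one_ne_zero]
    simpa [expo] using Nat.lt_succ_iff.mp (t j).2
  have hbox (c) (l) : Box B M (V c l - V c l₀ * G l) := by
    refine Box.sub ((hVbox c l).mono (by omega)) ?_
    exact (hw _ _ _ _ (hVbox c l₀) (hG l)).mono (by omega)
  have hVadd (c c') (l) : V (c + c') l = V c l + V c' l := by
    simp only [hV, Pi.add_apply, map_add, add_smul, Finset.sum_add_distrib]
  have hVsmul (x : k) (c) (l) : V (x • c) l = (MvPolynomial.C x : MvPolynomial σ k) • V c l := by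
    simp only [hV, Pi.smul_apply, smul_eq_mul, map_mul, mul_smul, Finset.smul_sum]
  let T : ((Fin D × (σ → Fin (L + 1))) × (Fin D × (σ → Fin (m + 1))) → k) →ₗ[k]
      ({l : Fin D // l ≠ l₀} × (Fin D × (σ → Fin (M + 1))) → k) :=
    { toFun := fun c s => coeff (expo s.2.2) (B.repr (V c s.1 - V c l₀ * G s.1) s.2.1)
      map_add' := fun c c' => by
        ext s
        rw [Pi.add_apply, ← coeff_add, ← Finsupp.add_apply, ← map_add, hVadd, hVadd]
        congr 3
        ring
      map_smul' := fun x c => by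
        ext s
        rw [RingHom.id_apply, Pi.smul_apply, smul_eq_mul, ← coeff_C_mul,
          ← smul_eq_mul (a := MvPolynomial.C x), ← Finsupp.smul_apply, ← map_smul, hVsmul, hVsmul, smul_sub,
          smul_mul_assoc] }
  obtain ⟨c, hc, hc0⟩ := Submodule.exists_mem_ne_zero_of_ne_bot
    (LinearMap.ker_ne_bot_of_finrank_lt (f := T) (by simpa using hlt))
  refine ⟨c, hc0, fun l => ?_⟩
  change V c l = V c l₀ * G l
  by_cases hl : l = l₀
  · rw [hl, hl₀, mul_one]
  · rw [← sub_eq_zero]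
    exact (hbox c l).eq_zero fun i t => congrFun (LinearMap.mem_ker.mp hc) (⟨l, hl⟩, (i, t))

end Auxiliary

section Stepanov

variable {σ k C : Type} [Field k] [CommRing C] [Algebra (MvPolynomial σ k) C] {D : ℕ}
  {B : Module.Basis (Fin D) (MvPolynomial σ k) C} {y : C}
  {f : Polynomial (MvPolynomial σ k)} {Δ : MvPolynomial σ k}

/-- Stepanov's auxiliary function: a nonzero element of small degree vanishing at all points whose
base coordinates are fixed by the Frobenius while the last coordinate is not. -/
lemma IsHypersurface.exists_stepanov [Fintype σ] [IsAlgClosed k] (p : ℕ) [hp : Fact p.Prime]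
    [CharP k p] (H : IsHypersurface B y f Δ) :
    ∃ κ A E₀, ∀ E ≥ E₀, ∃ R : C, R ≠ 0 ∧ (∃ m, m + p ^ κ * p ^ E ≤ A + p ^ (E + 2 * κ) ∧
      Box B m R) ∧ ∀ (a : σ → k) (e : C →+* k), (∀ r, e (algebraMap _ _ r) = eval a r) →
        (∀ j, a j ^ p ^ (E + 2 * κ) = a j) →
        (f.map (eval a)).eval (e y ^ p ^ (E + 2 * κ)) = 0 →
        e y ^ p ^ (E + 2 * κ) ≠ e y → e R = 0 := by
  classical
  obtain ⟨w, hw⟩ := Box.exists_mul B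
  obtain ⟨G, hG1, hGf⟩ := H.exists_cofactor
  set l₀ : Fin D := ⟨D - 1, Nat.sub_lt H.pos one_pos⟩
  obtain ⟨w₂, hw₂⟩ := Box.exists_forall B G
  set d := Fintype.card σ with hd
  set L := 2 * d * w * D with hL
  obtain ⟨N, hN⟩ := H.nonvanishing B p L
  set κ := N + 2 * d * D + 1 with hκ
  set q₀ := p ^ κ with hq₀
  have hκq : κ < q₀ := Nat.lt_pow_self hp.out.one_lt
  refine ⟨κ, L + q₀ * w + w, w₂ + w, fun E hE => ?_⟩
  set P' := p ^ E with hP'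
  have hEP : E < P' := Nat.lt_pow_self hp.out.one_lt
  have hP : p ^ (E + κ) = q₀ * P' := by rw [pow_add, mul_comm]
  have hQ : p ^ (E + 2 * κ) = q₀ * (q₀ * P') := by rw [← hP, hq₀, ← pow_add]; congr 1; ring
  have hPpos : 0 < q₀ * P' := Nat.mul_pos (by omega) (by omega)
  obtain ⟨m, hm⟩ : ∃ m, P' * (q₀ - 1) = m + 1 :=
    Nat.exists_eq_add_one.mpr (Nat.mul_pos (by omega) (by omega))
  have hm' : m + 1 + P' = q₀ * P' := by
    rw [← hm, ← Nat.mul_succ, Nat.succ_eq_add_one, Nat.sub_add_cancel (by omega), mul_comm]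
  have hlt : (D - 1) * (D * (q₀ * P' * (L + w) + m + w₂ + w + 1) ^ d) <
      D * (L + 1) ^ d * (D * (m + 1) ^ d) := by
    have h1 : q₀ * P' * (L + w) + m + w₂ + w + 1 ≤ q₀ * (L + 1 + w) * P' := by
      have : q₀ * (L + 1 + w) * P' = q₀ * P' * (L + w) + q₀ * P' := by ring
      omega
    calc (D - 1) * (D * (q₀ * P' * (L + w) + m + w₂ + w + 1) ^ d)
        ≤ (D - 1) * (D * (q₀ * (L + 1 + w) * P') ^ d) := by gcongr
      _ = D * P' ^ d * ((D - 1) * (q₀ * (L + 1 + w)) ^ d) := by rw [mul_pow _ P']; ring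
      _ < D * P' ^ d * (D * ((L + 1) * (q₀ - 1)) ^ d) := by
        have := bernoulli_bound (d := d) (w := w) (X := L + 1) (q₀ := q₀) H.pos (by omega)
          (by omega)
        have hD := H.pos
        have hP0 : 0 < P' := by omega
        gcongr
      _ = D * (L + 1) ^ d * (D * (m + 1) ^ d) := by rw [← hm, mul_pow, mul_pow]; ring
  obtain ⟨c, hc0, hc⟩ := exists_siegel hw hw₂ l₀ hG1 hPpos le_rfl hlt
  have hQpos : 0 < p ^ (E + 2 * κ) := by have := hp.out.pos; positivity
  choose c' hc' using fun s => IsAlgClosed.exists_pow_nat_eq (c s) hQpos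
  set g : Fin D × (σ → Fin (L + 1)) → C := fun α =>
    ∑ β, (MvPolynomial.C (c' (α, β)) : MvPolynomial σ k) • mon B (m := m + 1) β with hg
  have hgbox (α) : Box B m (g α) := Box.sum fun β _ => (box_mon β).C_smul _
  have hg0 : g ≠ 0 := by
    obtain ⟨s, hs⟩ := Function.ne_iff.mp hc0
    intro h
    refine sum_mon_ne_zero (B := B) (c := fun β => c' (s.1, β)) (fun h' => hs ?_) (congrFun h s.1)
    rw [← hc', show c' s = 0 from congrFun h' s.2, zero_pow hQpos.ne', Pi.zero_apply]
  refine ⟨∑ α, mon B α * g α ^ p ^ κ, fun h => hg0 (hN κ (by omega) g h),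
    ⟨L + q₀ * (m + w) + w, ?_, ?_⟩, fun a e he ha hfa hne => ?_⟩
  · rw [hQ, ← hm']
    ring_nf
    omega
  · exact Box.sum fun α _ => hw _ _ _ _ (box_mon α) (Box.pow hw (hgbox α) (by omega))
  set z := e y ^ p ^ (E + 2 * κ) with hz
  have hmonQ (β : Fin D × (σ → Fin (m + 1))) :
      e (mon B β) ^ p ^ (E + 2 * κ) = eval a (monomial (expo β.2) 1) * z ^ (β.1 : ℕ) := by
    rw [mon, Algebra.smul_def, map_mul, he, mul_pow, H.basis_eq, map_pow, hz, ← pow_mul, ← pow_mul,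
      mul_comm (β.1 : ℕ), eval_monomial, one_mul, Finsupp.prod, ← Finset.prod_pow]
    simp only [← pow_mul, mul_comm _ (p ^ _)]
    simp only [pow_mul, ha]
  have hGz : ∑ l, e (G l) * z ^ (l : ℕ) = 0 := by
    rw [Polynomial.eval_map] at hfa
    have h1 := congrArg (Polynomial.eval₂ e z) hGf
    rw [Polynomial.eval₂_mul, Polynomial.eval₂_sub, Polynomial.eval₂_X, Polynomial.eval₂_C,
      Polynomial.eval₂_map, show e.comp (algebraMap _ C) = eval a from RingHom.ext he,
      hfa, mul_eq_zero, sub_eq_zero, or_iff_left hne,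
      Polynomial.eval₂_finsetSum] at h1
    simpa using h1
  obtain ⟨W, hV⟩ : ∃ W, ∀ l, (∑ α, ∑ t, c (α, (l, t)) * (eval a (monomial (expo t) 1) *
      e (mon B α) ^ (q₀ * P'))) = W * e (G l) :=
    ⟨_, fun l => by simpa [map_sum, Algebra.smul_def, he] using congrArg e (hc l)⟩
  have : e (∑ α, mon B α * g α ^ p ^ κ) ^ p ^ (E + κ) = 0 := by
    calc e (∑ α, mon B α * g α ^ p ^ κ) ^ p ^ (E + κ)
        = ∑ α, e (mon B α) ^ (q₀ * P') * e (g α) ^ p ^ (E + 2 * κ) := by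
          rw [map_sum, sum_pow_char_pow]
          refine Finset.sum_congr rfl fun α _ => ?_
          rw [map_mul, map_pow, mul_pow, ← pow_mul, hP, hQ]
      _ = ∑ α, ∑ β, e (mon B α) ^ (q₀ * P') * (c (α, β) *
            (eval a (monomial (expo β.2) 1) * z ^ (β.1 : ℕ))) := by
          refine Finset.sum_congr rfl fun α _ => ?_
          rw [hg, map_sum, sum_pow_char_pow, Finset.mul_sum]
          refine Finset.sum_congr rfl fun β _ => ?_
          rw [Algebra.smul_def, map_mul, he, mul_pow, hmonQ, eval_C, hc']
      _ = ∑ l, (∑ α, ∑ t, c (α, (l, t)) * (eval a (monomial (expo t) 1) *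
            e (mon B α) ^ (q₀ * P'))) * z ^ (l : ℕ) := by
          simp only [Finset.sum_mul]
          refine (Finset.sum_congr rfl fun α _ => ?_).trans Finset.sum_comm
          rw [Fintype.sum_prod_type]
          refine Finset.sum_congr rfl fun l _ => Finset.sum_congr rfl fun t _ => ?_
          ring
      _ = 0 := by
          simp only [hV, mul_assoc, ← Finset.mul_sum, hGz, mul_zero]
  exact eq_zero_of_pow_eq_zero this

end Stepanov

section Counting

variable {σ k C : Type} [Field k] [CommRing C] [Algebra (MvPolynomial σ k) C] {D : ℕ}
  {B : Module.Basis (Fin D) (MvPolynomial σ k) C} {y : C}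
  {f : Polynomial (MvPolynomial σ k)} {Δ : MvPolynomial σ k}

/-- An element vanishing on all points above a large grid is zero. -/
lemma IsHypersurface.eq_zero_of_forall [Finite σ] [IsAlgClosed k] (H : IsHypersurface B y f Δ)
    {T : Finset k} {h : C} {m t : ℕ} (ht : ∀ j, degreeOf j Δ ≤ t) (hh : Box B m h)
    (hT : m + t < T.card)
    (h0 : ∀ (a : σ → k) (e : C →+* k), (∀ r, e (algebraMap _ _ r) = eval a r) →
      (∀ j, a j ∈ T) → eval a Δ ≠ 0 → e h = 0) : h = 0 := by
  classical
  rw [← B.repr.map_eq_zero_iff]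
  ext1 i
  rw [Finsupp.zero_apply]
  refine (mul_eq_zero.mp (MvPolynomial.eq_zero_of_eval_zero_at_prod_finset
    (Δ * B.repr h i) (fun _ => T) (fun j => ?_) fun a ha => ?_)).resolve_left H.ne_zero
  · have h1 := degreeOf_mul_le j Δ (B.repr h i)
    have h2 := ht j
    have h3 := hh i j
    omega
  rw [map_mul, mul_eq_zero, or_iff_not_imp_left]
  intro hΔ
  set P : Polynomial k :=
    ∑ i : Fin D, Polynomial.C (eval a (B.repr h i)) * Polynomial.X ^ (i : ℕ) with hP
  have hdeg : P.degree < D := Polynomial.degree_sum_fin_lt _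
  have hcoeff : P.coeff i = eval a (B.repr h i) := by
    simp [hP, Polynomial.coeff_C_mul, Polynomial.coeff_X_pow, Fin.val_inj]
  rw [← hcoeff]
  have hcard : (f.map (eval a)).roots.toFinset.card = D := by
    rw [Multiset.toFinset_card_of_nodup (Polynomial.nodup_roots (H.separable a hΔ)),
      IsAlgClosed.card_roots_eq_natDegree, H.monic.natDegree_map, H.natDegree_eq]
  rw [Polynomial.eq_zero_of_degree_lt_of_eval_finset_eq_zero (f := P)
    (f.map (eval a)).roots.toFinset (by rwa [hcard]) fun b hb => ?_, Polynomial.coeff_zero]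
  rw [Multiset.mem_toFinset, Polynomial.mem_roots'] at hb
  obtain ⟨e, he, heb⟩ := H.exists_point hb.2
  rw [← h0 a e he ha hΔ]
  conv_rhs => rw [← B.sum_repr h]
  simp [hP, Polynomial.eval_finsetSum, Algebra.smul_def, he, H.basis_eq, heb]

lemma IsHypersurface.pow_le_ncard [Fintype σ] [IsAlgClosed k] (H : IsHypersurface B y f Δ)
    {w : ℕ} (hw : ∀ m n u v, Box B m u → Box B n v → Box B (m + n + w) (u * v))
    {T : Finset k} {R : C} (hR : R ≠ 0) {m n t : ℕ} (ht : ∀ j, degreeOf j Δ ≤ t)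
    (hbox : Box B m R) (hT : m + n + w + t < T.card) {Z : Set ((σ → k) × k)} (hZ : Z.Finite)
    (hZf : ∀ z ∈ Z, (f.map (eval z.1)).eval z.2 = 0)
    (hRZ : ∀ (a : σ → k) (e : C →+* k), (∀ r, e (algebraMap _ _ r) = eval a r) →
      (∀ j, a j ∈ T) → eval a Δ ≠ 0 → (a, e y) ∉ Z → e R = 0) :
    (n + 1) ^ Fintype.card σ ≤ Z.ncard := by
  classical
  have := H.isDomain
  have := hZ.fintype
  choose e he hey using fun z : Z => H.exists_point (hZf z z.2)
  let S : (Fin D × (σ → Fin (n + 1)) → k) → C :=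
    fun c => ∑ α, (MvPolynomial.C (c α) : MvPolynomial σ k) • mon B α
  have hS (c) (z : Z) : e z (S c) = ∑ α, c α * e z (mon B α) := by
    simp [S, map_sum, Algebra.smul_def, he]
  let V : (Fin D × (σ → Fin (n + 1)) → k) →ₗ[k] (Z → k) :=
    { toFun := fun c z => e z R * e z (S c)
      map_add' := fun c c' => by
        ext z
        simp [hS, add_mul, Finset.sum_add_distrib, mul_add]
      map_smul' := fun x c => by
        ext z
        simp [hS, mul_assoc, ← Finset.mul_sum, mul_left_comm] }
  have hV : Function.Injective V := by
    rw [injective_iff_map_eq_zero]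
    intro c hc
    by_contra hc0
    refine mul_ne_zero hR (sum_mon_ne_zero (B := B) hc0) ?_
    refine H.eq_zero_of_forall ht (hw _ _ _ _ hbox (Box.sum fun α _ => (box_mon α).C_smul _))
      hT fun a e' he' ha hΔ => ?_
    by_cases hz : (a, e' y) ∈ Z
    · have : e' = e ⟨_, hz⟩ := ringHom_ext_of_basis (B := B) H.basis_eq
        (fun r => by rw [he, he']) (by rw [hey])
      rw [this, map_mul]
      exact congrFun hc ⟨_, hz⟩
    · rw [map_mul, hRZ a e' he' ha hΔ hz, zero_mul]
  have h1 := LinearMap.finrank_le_finrank_of_injective hV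
  rw [Module.finrank_fintype_fun_eq_card, Module.finrank_fintype_fun_eq_card,
    ← Nat.card_eq_fintype_card (α := Z), Nat.card_coe_set_eq] at h1
  rw [Fintype.card_prod, Fintype.card_fun, Fintype.card_fin, Fintype.card_fin] at h1
  exact (Nat.le_mul_of_pos_left _ H.pos).trans h1

/-- Points of the étale locus of a hypersurface fixed by the `Q`-power Frobenius. -/
def fixedPoints (f : Polynomial (MvPolynomial σ k)) (Δ : MvPolynomial σ k) (Q : ℕ) :
    Set ((σ → k) × k) :=
  {z | (∀ j, z.1 j ^ Q = z.1 j) ∧ z.2 ^ Q = z.2 ∧ (f.map (eval z.1)).eval z.2 = 0 ∧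
    eval z.1 Δ ≠ 0}

lemma exists_finset_pow_eq (k : Type) [Field k] [IsAlgClosed k] (p : ℕ) [hp : Fact p.Prime]
    [CharP k p] {s : ℕ} (hs : s ≠ 0) :
    ∃ T : Finset k, T.card = p ^ s ∧ ∀ x, x ∈ T ↔ x ^ p ^ s = x := by
  classical
  have h1 : 1 < p ^ s := Nat.one_lt_pow hs hp.out.one_lt
  refine ⟨(Polynomial.X ^ p ^ s - Polynomial.X : Polynomial k).roots.toFinset, ?_, fun x => ?_⟩
  · rw [Multiset.toFinset_card_of_nodup (Polynomial.nodup_roots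
      (galois_poly_separable p _ (dvd_pow_self p hs))),
      IsAlgClosed.card_roots_eq_natDegree, FiniteField.X_pow_card_sub_X_natDegree_eq k h1]
  · simp [Polynomial.mem_roots', FiniteField.X_pow_card_sub_X_ne_zero k h1, sub_eq_zero]

lemma finite_fixedPoints [Finite σ] [IsAlgClosed k] (p : ℕ) [Fact p.Prime] [CharP k p] {s : ℕ}
    (hs : s ≠ 0) : (fixedPoints f Δ (p ^ s)).Finite := by
  obtain ⟨T, -, hT⟩ := exists_finset_pow_eq k p hs
  refine ((Set.Finite.pi' fun _ : σ => T.finite_toSet).prod T.finite_toSet).subset ?_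
  rintro ⟨a, b⟩ ⟨ha, hb, -⟩
  exact ⟨fun j => (hT _).mpr (ha j), (hT _).mpr hb⟩

theorem IsHypersurface.exists_le_card_fixedPoints [Fintype σ] [IsAlgClosed k] (p : ℕ)
    [hp : Fact p.Prime] [CharP k p] (H : IsHypersurface B y f Δ) :
    ∃ c s₀, 0 < c ∧ ∀ s ≥ s₀,
      (∀ a b, (∀ j, a j ^ p ^ s = a j) → (f.map (eval a)).eval b = 0 →
        (f.map (eval a)).eval (b ^ p ^ s) = 0) →
      (p ^ s) ^ Fintype.card σ ≤ c * (fixedPoints f Δ (p ^ s)).ncard := by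
  obtain ⟨κ, A, E₀, hst⟩ := H.exists_stepanov p
  obtain ⟨w, hw⟩ := Box.exists_mul B
  obtain ⟨t, ht⟩ := exists_forall_degreeOf_le Δ
  have hp1 := hp.out.one_lt
  refine ⟨(p ^ (2 * κ + 1)) ^ Fintype.card σ, E₀ + (A + w + t) + 2 * κ + 1, by positivity,
    fun s hs hf => ?_⟩
  obtain ⟨E, rfl⟩ : ∃ E, s = (E + 1) + 2 * κ := ⟨s - 2 * κ - 1, by omega⟩
  obtain ⟨R, hR, ⟨m, hm, hbox⟩, hvan⟩ := hst (E + 1) (by omega)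
  obtain ⟨T, hTc, hT⟩ := exists_finset_pow_eq k p (s := (E + 1) + 2 * κ) (by omega)
  have hE : E < p ^ E := Nat.lt_pow_self hp1
  have hE' : 2 * p ^ E ≤ p ^ κ * p ^ (E + 1) := by
    rw [pow_succ, mul_comm (p ^ E)]
    exact (Nat.mul_le_mul_right _ hp1).trans (Nat.le_mul_of_pos_left _ (by positivity))
  have hle := H.pow_le_ncard hw (T := T) (n := p ^ E - 1) hR ht hbox (by omega)
    (finite_fixedPoints (f := f) (Δ := Δ) p (s := (E + 1) + 2 * κ) (by omega))
    (fun z hz => hz.2.2.1) fun a e he ha hΔ hz => ?_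
  · rw [Nat.sub_add_cancel (by omega)] at hle
    calc (p ^ (E + 1 + 2 * κ)) ^ Fintype.card σ
        = (p ^ (2 * κ + 1)) ^ Fintype.card σ * (p ^ E) ^ Fintype.card σ := by
          rw [← mul_pow, ← pow_add]
          congr 2
          ring
      _ ≤ _ := Nat.mul_le_mul_left _ hle
  · have ha' : ∀ j, a j ^ p ^ (E + 1 + 2 * κ) = a j := fun j => (hT _).mp (ha j)
    have hfe : (f.map (eval a)).eval (e y) = 0 := by
      have := congrArg e H.root
      rwa [Polynomial.aeval_def, Polynomial.hom_eval₂, map_zero,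
        show e.comp (algebraMap _ C) = eval a from RingHom.ext he, ← Polynomial.eval_map] at this
    exact hvan a e he ha' (hf a _ ha' hfe) fun hy => hz ⟨ha', hy, hfe, hΔ⟩

end Counting

/-- A finite separable extension of the fraction field of an integrally closed domain `R` is
generated by an element integral over `R`. -/
lemma exists_integral_primitive (R E L : Type) [CommRing R] [IsDomain R] [IsIntegrallyClosed R]
    [Field E] [Algebra R E] [IsFractionRing R E] [Field L] [Algebra E L] [Algebra R L]
    [IsScalarTower R E L] [FiniteDimensional E L] [Algebra.IsSeparable E L] :
    ∃ (y : L) (f : Polynomial R), f.Monic ∧ (∀ P, Polynomial.aeval y P = 0 ↔ f ∣ P) ∧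
      (∀ z : L, ∃ δ : R, δ ≠ 0 ∧ ∃ P : Polynomial R, algebraMap R L δ * z = Polynomial.aeval y P) ∧
      ∃ Δ : R, Δ ≠ 0 ∧ ∃ U V, U * f + V * f.derivative = Polynomial.C Δ := by
  have hinj : Function.Injective (algebraMap R L) := by
    rw [IsScalarTower.algebraMap_eq R E L]
    exact (algebraMap E L).injective.comp (IsFractionRing.injective R E)
  have : FaithfulSMul R L := (faithfulSMul_iff_algebraMap_injective R L).mpr hinj
  obtain ⟨α, hα⟩ := Field.exists_primitive_element E L
  have hα' : IsAlgebraic R α :=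
    (IsFractionRing.isAlgebraic_iff R E L).mpr (Algebra.IsAlgebraic.isAlgebraic α)
  obtain ⟨h, hh, hint⟩ := hα'.exists_integral_multiple
  have hhE : algebraMap R E h ≠ 0 := fun h0 =>
    hh (IsFractionRing.injective R E (by rw [h0, map_zero]))
  have hgen : Algebra.adjoin E {h • α} = ⊤ := by
    rw [← IntermediateField.adjoin_simple_eq_top_iff_of_isAlgebraic
      (Algebra.IsAlgebraic.isAlgebraic _), eq_top_iff, ← hα,
      IntermediateField.adjoin_simple_le_iff]
    have h1 : α = (algebraMap R E h)⁻¹ • (h • α) := by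
      rw [← algebraMap_smul E h α, smul_smul, inv_mul_cancel₀ hhE, one_smul]
    have h2 := IntermediateField.smul_mem _ (IntermediateField.mem_adjoin_simple_self E (h • α))
      (x := (algebraMap R E h)⁻¹)
    rwa [← h1] at h2
  have hmin := minpoly.isIntegrallyClosed_eq_field_fractions' E hint
  refine ⟨h • α, minpoly R (h • α), minpoly.monic hint,
    minpoly.isIntegrallyClosed_dvd_iff hint, fun z => ?_, ?_⟩
  · have hz : z ∈ Algebra.adjoin E {h • α} := hgen ▸ trivial
    obtain ⟨P, rfl⟩ := Algebra.adjoin_singleton_eq_range_aeval E (h • α) ▸ hz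
    obtain ⟨b, hb, hP⟩ := IsLocalization.integerNormalization_spec (nonZeroDivisors R) P
    refine ⟨b, nonZeroDivisors.ne_zero hb,
      IsLocalization.integerNormalization (nonZeroDivisors R) P, ?_⟩
    rw [← Polynomial.aeval_map_algebraMap E, hP, ← IsScalarTower.algebraMap_smul E b P, map_smul,
      algebraMap_smul, Algebra.smul_def b]
    rfl
  · have hsep : (minpoly E (h • α)).Separable := Algebra.IsSeparable.isSeparable E (h • α)
    rw [hmin] at hsep
    obtain ⟨u, v, huv⟩ := hsep
    obtain ⟨b, hb, hbu⟩ := IsLocalization.integerNormalization_spec (nonZeroDivisors R) u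
    obtain ⟨c, hc, hcv⟩ := IsLocalization.integerNormalization_spec (nonZeroDivisors R) v
    set u' := IsLocalization.integerNormalization (nonZeroDivisors R) u
    set v' := IsLocalization.integerNormalization (nonZeroDivisors R) v
    refine ⟨b * c, nonZeroDivisors.ne_zero (mul_mem hb hc), Polynomial.C c * u',
      Polynomial.C b * v', ?_⟩
    apply Polynomial.map_injective _ (IsFractionRing.injective R E)
    rw [← IsScalarTower.algebraMap_smul E, Polynomial.smul_eq_C_mul] at hbu hcv
    simp only [Polynomial.map_add, Polynomial.map_mul, Polynomial.map_C, hbu, hcv, map_mul,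
      ← Polynomial.derivative_map]
    linear_combination (Polynomial.C (algebraMap R E b) * Polynomial.C (algebraMap R E c)) * huv

/-- A finitely generated field extension of a perfect field is the function field of a
hypersurface, generically étale over affine space. -/
lemma exists_hypersurface_model (F L : Type) [Field F] [PerfectField F] [Field L] [Algebra F L]
    [Algebra.EssFiniteType F L] :
    ∃ s : Finset L, IsTranscendenceBasis F ((↑) : s → L) ∧
      ∃ (y : L) (f : Polynomial (MvPolynomial s F)), f.Monic ∧
        (∀ P : Polynomial (MvPolynomial s F),
          P.eval₂ (aeval ((↑) : s → L)).toRingHom y = 0 ↔ f ∣ P) ∧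
        (∀ z : L, ∃ δ : MvPolynomial s F, δ ≠ 0 ∧ ∃ P : Polynomial (MvPolynomial s F),
          aeval ((↑) : s → L) δ * z = P.eval₂ (aeval ((↑) : s → L)).toRingHom y) ∧
        ∃ Δ : MvPolynomial s F, Δ ≠ 0 ∧ ∃ U V, U * f + V * f.derivative = Polynomial.C Δ := by
  obtain ⟨s, hs, hsep⟩ := exists_isTranscendenceBasis_and_isSeparable_of_perfectField (k := F)
    (K := L)
  refine ⟨s, hs, ?_⟩
  let E := IntermediateField.adjoin F (s : Set L)
  let ι : MvPolynomial s F →ₐ[F] L := aeval ((↑) : s → L)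
  have hι : Function.Injective ι := hs.1
  have hmem : ∀ r, ι r ∈ E.toSubalgebra := fun r => by
    have h1 : ι r ∈ Algebra.adjoin F (Set.range ((↑) : s → L)) :=
      Algebra.adjoin_range_eq_range_aeval F ((↑) : s → L) ▸ ⟨r, rfl⟩
    rw [Subtype.range_coe] at h1
    exact IntermediateField.algebra_adjoin_le_adjoin F _ h1
  let ιE : MvPolynomial s F →ₐ[F] E := ι.codRestrict E.toSubalgebra hmem
  let : Algebra (MvPolynomial s F) L := ι.toRingHom.toAlgebra
  let : Algebra (MvPolynomial s F) E := ιE.toRingHom.toAlgebra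
  have : IsScalarTower (MvPolynomial s F) E L := IsScalarTower.of_algebraMap_eq fun _ => rfl
  have hιE : Function.Injective (algebraMap (MvPolynomial s F) E) := fun a b h =>
    hι (congrArg Subtype.val h)
  have : FaithfulSMul (MvPolynomial s F) E :=
    (faithfulSMul_iff_algebraMap_injective _ _).mpr hιE
  have : IsFractionRing (MvPolynomial s F) E := by
    refine IsFractionRing.of_field _ _ fun z => ?_
    obtain ⟨a, b, hab⟩ := (IntermediateField.mem_adjoin_iff F (z : L)).mp z.2
    exact ⟨a, b, Subtype.ext hab⟩
  have : Algebra.IsSeparable E L := hsep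
  have : Algebra.EssFiniteType E L := Algebra.EssFiniteType.of_comp F E L
  have : FiniteDimensional E L := by
    exact Algebra.finite_of_essFiniteType_of_isAlgebraic
  exact exists_integral_primitive (MvPolynomial s F) E L

open TensorProduct in
/-- If `A ⊗ k` is a domain, then so is `Frac A ⊗ k`. -/
lemma isDomain_tensor_of_isFractionRing (F A L k : Type) [Field F] [CommRing A] [IsDomain A]
    [Algebra F A] [Field L] [Algebra A L] [IsFractionRing A L] [Algebra F L] [IsScalarTower F A L]
    [Field k] [Algebra F k] [IsDomain (A ⊗[F] k)] : IsDomain (L ⊗[F] k) := by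
  let g : A ⊗[F] k →ₐ[F] L ⊗[F] k :=
    Algebra.TensorProduct.map (IsScalarTower.toAlgHom F A L) (AlgHom.id F k)
  have hg : Function.Injective g :=
    Module.Flat.rTensor_preserves_injective_linearMap (M := k)
      (IsScalarTower.toAlgHom F A L).toLinearMap (IsFractionRing.injective A L)
  have hunit : ∀ a : A, a ≠ 0 → IsUnit ((algebraMap A L a) ⊗ₜ[F] (1 : k)) := fun a ha => by
    have h1 : IsUnit (algebraMap A L a) := by
      rw [isUnit_iff_ne_zero]
      exact (map_ne_zero_iff _ (IsFractionRing.injective A L)).mpr ha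
    exact h1.map (Algebra.TensorProduct.includeLeftRingHom : L →+* L ⊗[F] k)
  have hden : ∀ z : L ⊗[F] k, ∃ a : A, a ≠ 0 ∧
      ∃ z', (algebraMap A L a) ⊗ₜ[F] (1 : k) * z = g z' := by
    intro z
    induction z with
    | zero => exact ⟨1, one_ne_zero, 0, by simp⟩
    | tmul l c =>
      obtain ⟨n, a, ha, rfl⟩ := IsFractionRing.div_surjective (A := A) l
      refine ⟨a, nonZeroDivisors.ne_zero ha, n ⊗ₜ c, ?_⟩
      have h1 : algebraMap A L a ≠ 0 :=
        (map_ne_zero_iff _ (IsFractionRing.injective A L)).mpr (nonZeroDivisors.ne_zero ha)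
      rw [Algebra.TensorProduct.tmul_mul_tmul, one_mul, mul_div_cancel₀ _ h1]
      simp [g]
    | add z w hz hw =>
      obtain ⟨a, ha, z', hz'⟩ := hz
      obtain ⟨b, hb, w', hw'⟩ := hw
      refine ⟨a * b, mul_ne_zero ha hb, b ⊗ₜ 1 * z' + a ⊗ₜ 1 * w', ?_⟩
      have h1 : ∀ a : A, g (a ⊗ₜ 1) = algebraMap A L a ⊗ₜ 1 := fun a => by simp [g]
      have h2 : (algebraMap A L (a * b)) ⊗ₜ[F] (1 : k)
          = (algebraMap A L a ⊗ₜ[F] (1 : k)) * (algebraMap A L b ⊗ₜ[F] (1 : k)) := by simp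
      rw [map_add g, map_mul g, map_mul g, ← hz', ← hw', h1, h1, h2]
      ring
  have : Nontrivial (L ⊗[F] k) := hg.nontrivial
  have : NoZeroDivisors (L ⊗[F] k) := ⟨fun {z w} h => by
    obtain ⟨a, ha, z', hz'⟩ := hden z
    obtain ⟨b, hb, w', hw'⟩ := hden w
    have h1 : g (z' * w') = 0 := by
      rw [map_mul, ← hz', ← hw', mul_mul_mul_comm, h, mul_zero]
    rcases mul_eq_zero.mp ((map_eq_zero_iff g hg).mp h1) with h2 | h2
    · left
      rw [h2, map_zero] at hz'
      exact (hunit a ha).mul_right_eq_zero.mp hz'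
    · right
      rw [h2, map_zero] at hw'
      exact (hunit b hb).mul_right_eq_zero.mp hw'⟩
  exact NoZeroDivisors.to_isDomain _

section BaseChange

variable {σ F k L : Type} [Field F] [Field k] [Algebra F k] [Field L] [Algebra F L]

lemma exists_sum_basis_map {ι : Type} (b : Module.Basis ι F k)
    (P : Polynomial (MvPolynomial σ k)) :
    ∃ c : ι →₀ Polynomial (MvPolynomial σ F), P = c.sum fun i p =>
      Polynomial.C (MvPolynomial.C (b i)) * p.map (MvPolynomial.map (algebraMap F k)) := by
  have hadd : ∀ c c' : ι →₀ Polynomial (MvPolynomial σ F), ((c + c').sum fun i p =>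
      Polynomial.C (MvPolynomial.C (b i)) * p.map (MvPolynomial.map (algebraMap F k))) =
      (c.sum fun i p =>
        Polynomial.C (MvPolynomial.C (b i)) * p.map (MvPolynomial.map (algebraMap F k))) +
      c'.sum fun i p =>
        Polynomial.C (MvPolynomial.C (b i)) * p.map (MvPolynomial.map (algebraMap F k)) :=
    fun c c' => Finsupp.sum_add_index' (by simp) (by simp [mul_add])
  induction P using Polynomial.induction_on' with
  | add P Q hP hQ =>
    obtain ⟨c, rfl⟩ := hP
    obtain ⟨c', rfl⟩ := hQ
    exact ⟨c + c', (hadd c c').symm⟩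
  | monomial n r =>
    induction r using MvPolynomial.induction_on' with
    | add r r' hr hr' =>
      obtain ⟨c, hc⟩ := hr
      obtain ⟨c', hc'⟩ := hr'
      exact ⟨c + c', by rw [hadd, ← hc, ← hc', map_add]⟩
    | monomial m a =>
      refine ⟨(b.repr a).mapRange (fun t => Polynomial.monomial n (monomial m t)) (by simp), ?_⟩
      rw [Finsupp.sum_mapRange_index (by simp)]
      conv_lhs => rw [← b.linearCombination_repr a]
      rw [Finsupp.linearCombination_apply, Finsupp.sum, Finsupp.sum, map_sum, map_sum]
      refine Finset.sum_congr rfl fun i _ => ?_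
      rw [Polynomial.map_monomial, map_monomial, Polynomial.C_mul_monomial, C_mul_monomial,
        Algebra.smul_def, mul_comm]

/-- The hypersurface model of a geometrically integral function field stays integral over `k`. -/
lemma isDomain_adjoinRoot_map {x : σ → L} {y : L} {f : Polynomial (MvPolynomial σ F)}
    (hdvd : ∀ P : Polynomial (MvPolynomial σ F),
      P.eval₂ (aeval (R := F) x).toRingHom y = 0 ↔ f ∣ P)
    [IsDomain (TensorProduct F L k)] :
    IsDomain (AdjoinRoot (f.map (MvPolynomial.map (algebraMap F k)))) := by
  let φ : MvPolynomial σ k →+* TensorProduct F L k :=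
    eval₂Hom (Algebra.TensorProduct.includeRight (R := F) (A := L) (B := k)).toRingHom
      fun i => x i ⊗ₜ 1
  have hφ : φ.comp (MvPolynomial.map (algebraMap F k)) =
      (Algebra.TensorProduct.includeLeftRingHom (R := F) (A := L) (B := k)).comp
        (aeval (R := F) x).toRingHom := by
    ext r
    · simp [φ, Algebra.TensorProduct.algebraMap_apply]
    · simp [φ]
  have heval : ∀ P : Polynomial (MvPolynomial σ F),
      (P.map (MvPolynomial.map (algebraMap F k))).eval₂ φ (y ⊗ₜ 1) =
        (P.eval₂ (aeval (R := F) x).toRingHom y) ⊗ₜ 1 := fun P => by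
    rw [Polynomial.eval₂_map, hφ]
    exact (Polynomial.hom_eval₂ P _ Algebra.TensorProduct.includeLeftRingHom y).symm
  have hroot : (f.map (MvPolynomial.map (algebraMap F k))).eval₂ φ (y ⊗ₜ 1) = 0 := by
    rw [heval, (hdvd f).mpr dvd_rfl, TensorProduct.zero_tmul]
  refine Function.Injective.isDomain (AdjoinRoot.lift φ (y ⊗ₜ 1) hroot) ?_
  rw [injective_iff_map_eq_zero]
  intro z
  induction z using AdjoinRoot.induction_on with
  | ih P =>
  intro hP
  rw [AdjoinRoot.lift_mk] at hP
  rw [AdjoinRoot.mk_eq_zero]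
  let b := Module.Basis.ofVectorSpace F k
  obtain ⟨c, rfl⟩ := exists_sum_basis_map b P
  let c' := c.mapRange (fun p => p.eval₂ (aeval (R := F) x).toRingHom y)
    (Polynomial.eval₂_zero _ _)
  have hc' : c' = 0 := by
    apply TensorProduct.sum_tmul_basis_right_eq_zero b
    rw [Finsupp.sum_mapRange_index (by simp), ← hP, Finsupp.sum, Finsupp.sum,
      Polynomial.eval₂_finsetSum]
    refine Finset.sum_congr rfl fun i _ => ?_
    rw [Polynomial.eval₂_mul, heval]
    simp [φ]
  refine Finset.dvd_sum fun i _ => Dvd.dvd.mul_left (Polynomial.map_dvd _ ?_) _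
  rw [← hdvd]
  simpa [c'] using DFunLike.congr_fun hc' i

end BaseChange

/-- The `K`-points of the hypersurface `f = 0` lying over the locus `Δ ≠ 0`. -/
def points {σ F : Type} [Field F] (f : Polynomial (MvPolynomial σ F)) (Δ : MvPolynomial σ F)
    (K : Type) [Field K] [Algebra F K] : Set ((σ → K) × K) :=
  {z | f.eval₂ (aeval (R := F) z.1).toRingHom z.2 = 0 ∧ aeval z.1 Δ ≠ 0}

section Points

variable {σ F k L : Type} [Field F] [Field k] [Algebra F k] [Field L] [Algebra F L]

lemma isHypersurface_adjoinRoot {x : σ → L} {y : L} {f : Polynomial (MvPolynomial σ F)}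
    (hf : (f.map (MvPolynomial.map (algebraMap F k))).Monic)
    (hdvd : ∀ P : Polynomial (MvPolynomial σ F),
      P.eval₂ (aeval (R := F) x).toRingHom y = 0 ↔ f ∣ P)
    {Δ : MvPolynomial σ F} (hΔ : Δ ≠ 0) {U V : Polynomial (MvPolynomial σ F)}
    (hUV : U * f + V * f.derivative = Polynomial.C Δ)
    [IsDomain (TensorProduct F L k)] :
    IsHypersurface (AdjoinRoot.powerBasisAux' hf) (AdjoinRoot.root _)
      (f.map (MvPolynomial.map (algebraMap F k))) (MvPolynomial.map (algebraMap F k) Δ) where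
  isDomain := isDomain_adjoinRoot_map hdvd
  basis_eq := (AdjoinRoot.powerBasis' hf).basis_eq_pow
  monic := hf
  natDegree_eq := rfl
  root := by rw [AdjoinRoot.aeval_eq, AdjoinRoot.mk_self]
  lift S _ g b h := ⟨AdjoinRoot.lift g b h, fun r => AdjoinRoot.lift_of h, AdjoinRoot.lift_root h⟩
  ne_zero := (map_ne_zero_iff _ (map_injective _ (algebraMap F k).injective)).mpr hΔ
  separable a ha := by
    have h1 := congrArg (fun P => (P.map (MvPolynomial.map (algebraMap F k))).map (eval a)) hUV
    simp only [Polynomial.map_add, Polynomial.map_mul, Polynomial.map_C,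
      ← Polynomial.derivative_map] at h1
    rw [Polynomial.separable_def]
    refine ⟨Polynomial.C (eval a (MvPolynomial.map (algebraMap F k) Δ))⁻¹ *
      (U.map (MvPolynomial.map (algebraMap F k))).map (eval a),
      Polynomial.C (eval a (MvPolynomial.map (algebraMap F k) Δ))⁻¹ *
      (V.map (MvPolynomial.map (algebraMap F k))).map (eval a), ?_⟩
    rw [mul_assoc, mul_assoc, ← mul_add, h1, ← Polynomial.C_mul, inv_mul_cancel₀ ha,
      Polynomial.C_1]

lemma eval_map_eval (f : Polynomial (MvPolynomial σ F)) (a : σ → k) (b : k) :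
    ((f.map (MvPolynomial.map (algebraMap F k))).map (eval a)).eval b =
      f.eval₂ (aeval (R := F) a).toRingHom b := by
  rw [Polynomial.eval_map, Polynomial.eval₂_map]
  congr 1
  ext <;> simp

lemma map_eval₂_aeval {k' : Type} [Field k'] [Algebra F k'] (f : Polynomial (MvPolynomial σ F))
    (φ : k →ₐ[F] k') (a : σ → k) (b : k) :
    φ (f.eval₂ (aeval (R := F) a).toRingHom b) =
      f.eval₂ (aeval (R := F) (φ ∘ a)).toRingHom (φ b) := by
  have h := Polynomial.hom_eval₂ f (aeval (R := F) a).toRingHom φ.toRingHom b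
  refine h.trans ?_
  congr 1
  ext <;> simp

lemma eval_map_pow_eq_zero (p : ℕ) [Fact p.Prime] [CharP k p] {s : ℕ}
    (hF : ∀ u : F, u ^ p ^ s = u) (f : Polynomial (MvPolynomial σ F)) {a : σ → k} {b : k}
    (ha : ∀ j, a j ^ p ^ s = a j)
    (h : ((f.map (MvPolynomial.map (algebraMap F k))).map (eval a)).eval b = 0) :
    ((f.map (MvPolynomial.map (algebraMap F k))).map (eval a)).eval (b ^ p ^ s) = 0 := by
  let φ : k →ₐ[F] k := { iterateFrobenius k p s with
    commutes' := fun u => by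
      change (iterateFrobenius k p s) (algebraMap F k u) = _
      rw [iterateFrobenius_def, ← map_pow, hF] }
  have hφ : ∀ c, φ c = c ^ p ^ s := fun c => iterateFrobenius_def p s c
  rw [eval_map_eval] at h ⊢
  have h1 := map_eval₂_aeval f φ a b
  have h2 : φ ∘ a = a := funext fun j => (hφ _).trans (ha j)
  rw [h, map_zero, h2, hφ] at h1
  exact h1.symm

/-- An element of an algebraic closure fixed by the Frobenius of `K` lies in `K`. -/
lemma mem_range_of_pow_eq [IsAlgClosed k] (p : ℕ) [Fact p.Prime] [CharP k p] {s : ℕ} (hs : s ≠ 0)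
    (K : Type) [Field K] [Finite K] [Algebra F K] (hK : Nat.card K = p ^ s) (i : K →ₐ[F] k) {z : k}
    (hz : z ^ p ^ s = z) : z ∈ Set.range i := by
  classical
  have := Fintype.ofFinite K
  rw [Nat.card_eq_fintype_card] at hK
  obtain ⟨T, hT, hmem⟩ := exists_finset_pow_eq k p hs
  have h1 : Finset.univ.image i = T := by
    refine Finset.eq_of_subset_of_card_le (fun w hw => ?_) ?_
    · obtain ⟨u, -, rfl⟩ := Finset.mem_image.mp hw
      rw [hmem, ← map_pow, ← hK, FiniteField.pow_card]
    · have hi : Function.Injective i := RingHom.injective (i : K →+* k)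
      rw [hT, Finset.card_image_of_injective _ hi, Finset.card_univ, hK]
  have h2 : z ∈ Finset.univ.image i := h1 ▸ (hmem z).mpr hz
  obtain ⟨u, -, hu⟩ := Finset.mem_image.mp h2
  exact ⟨u, hu⟩

lemma ncard_fixedPoints_le [Finite σ] [IsAlgClosed k] (p : ℕ) [Fact p.Prime] [CharP k p] {s : ℕ}
    (hs : s ≠ 0) (K : Type) [Field K] [Finite K] [Algebra F K] (hK : Nat.card K = p ^ s)
    (i : K →ₐ[F] k) (f : Polynomial (MvPolynomial σ F)) (Δ : MvPolynomial σ F) :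
    (fixedPoints (f.map (MvPolynomial.map (algebraMap F k))) (MvPolynomial.map (algebraMap F k) Δ)
      (p ^ s)).ncard ≤ (points f Δ K).ncard := by
  let I : (σ → K) × K → (σ → k) × k := fun z => (i ∘ z.1, i z.2)
  refine (Set.ncard_le_ncard (t := Set.image I (points f Δ K)) ?_ (Set.toFinite _)).trans
    (Set.ncard_image_le (Set.toFinite _))
  rintro ⟨a, b⟩ ⟨ha, hb, hf, hΔ⟩
  choose a' ha' using fun j => mem_range_of_pow_eq p hs K hK i (ha j)
  obtain ⟨b', rfl⟩ := mem_range_of_pow_eq p hs K hK i hb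
  obtain rfl : i ∘ a' = a := funext ha'
  refine ⟨(a', b'), ⟨?_, ?_⟩, rfl⟩
  · rw [eval_map_eval, ← map_eval₂_aeval] at hf
    exact (map_eq_zero_iff _ i.toRingHom.injective).mp hf
  · rintro h
    apply hΔ
    have h1 := (comp_aeval_apply (f := a') i Δ).symm.trans (congrArg i h)
    rw [map_zero] at h1
    rwa [eval_map, ← aeval_def]

/-- Lower bound for the number of points of a geometrically integral hypersurface. -/
theorem exists_pow_le_card_points [Fintype σ] [Finite F] (p : ℕ) [Fact p.Prime] [CharP F p]
    {x : σ → L} {y : L} {f : Polynomial (MvPolynomial σ F)} (hf : f.Monic)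
    (hdvd : ∀ P : Polynomial (MvPolynomial σ F),
      P.eval₂ (aeval (R := F) x).toRingHom y = 0 ↔ f ∣ P)
    {Δ : MvPolynomial σ F} (hΔ : Δ ≠ 0) {U V : Polynomial (MvPolynomial σ F)}
    (hUV : U * f + V * f.derivative = Polynomial.C Δ)
    [IsDomain (TensorProduct F L (AlgebraicClosure F))] :
    ∃ c s₀ : ℕ, 0 < c ∧ ∀ s ≥ s₀, ∀ (K : Type) [Field K] [Finite K] [Algebra F K],
      Nat.card K = p ^ s → (p ^ s) ^ Fintype.card σ ≤ c * (points f Δ K).ncard := by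
  have : CharP (AlgebraicClosure F) p := charP_of_injective_algebraMap
    (algebraMap F (AlgebraicClosure F)).injective p
  obtain ⟨c, s₀, hc, h⟩ := (isHypersurface_adjoinRoot (k := AlgebraicClosure F) (hf.map _) hdvd hΔ
    hUV).exists_le_card_fixedPoints p
  refine ⟨c, s₀ + 1, hc, fun s hs K _ _ _ hK => ?_⟩
  have hF : ∀ u : F, u ^ p ^ s = u := fun u => by
    have := Fintype.ofFinite K
    apply (algebraMap F K).injective
    rw [map_pow, ← hK, Nat.card_eq_fintype_card, FiniteField.pow_card]
  have := Module.Finite.of_finite (R := F) (M := K)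
  refine (h s (by omega) fun a b ha hab => eval_map_pow_eq_zero p hF f ha hab).trans ?_
  exact Nat.mul_le_mul_left _ (ncard_fixedPoints_le p (by omega) K hK (IsAlgClosed.lift) f Δ)

end Points

section Model

variable {σ F L : Type} [Field F] [Field L] [Algebra F L]

lemma exists_common_denominator {x : σ → L} {y : L}
    (hden : ∀ z : L, ∃ δ : MvPolynomial σ F, δ ≠ 0 ∧ ∃ P : Polynomial (MvPolynomial σ F),
      aeval x δ * z = P.eval₂ (aeval (R := F) x).toRingHom y) (Z : Finset L) :
    ∃ δ : MvPolynomial σ F, δ ≠ 0 ∧ ∀ z ∈ Z, ∃ P : Polynomial (MvPolynomial σ F),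
      aeval x δ * z = P.eval₂ (aeval (R := F) x).toRingHom y := by
  classical
  induction Z using Finset.induction_on with
  | empty => exact ⟨1, one_ne_zero, by simp⟩
  | insert z Z _ ih =>
    obtain ⟨δ, hδ, hZ⟩ := ih
    obtain ⟨ε, hε, P, hP⟩ := hden z
    refine ⟨δ * ε, mul_ne_zero hδ hε, fun w hw => ?_⟩
    rcases Finset.mem_insert.mp hw with rfl | hw
    · refine ⟨Polynomial.C δ * P, ?_⟩
      rw [Polynomial.eval₂_mul, Polynomial.eval₂_C, ← hP, map_mul, mul_assoc]
      rfl
    · obtain ⟨R, hR⟩ := hZ w hw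
      refine ⟨Polynomial.C ε * R, ?_⟩
      rw [Polynomial.eval₂_mul, Polynomial.eval₂_C, ← hR, map_mul, mul_comm (aeval x δ), mul_assoc]
      rfl

/-- Over a suitable open subset, the points of the hypersurface model specialise any prescribed
finite set of rational functions. -/
lemma exists_specialization {x : σ → L} (hx : AlgebraicIndependent F x) {y : L}
    {f : Polynomial (MvPolynomial σ F)}
    (hdvd : ∀ P : Polynomial (MvPolynomial σ F),
      P.eval₂ (aeval (R := F) x).toRingHom y = 0 ↔ f ∣ P)
    (hden : ∀ z : L, ∃ δ : MvPolynomial σ F, δ ≠ 0 ∧ ∃ P : Polynomial (MvPolynomial σ F),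
      aeval x δ * z = P.eval₂ (aeval (R := F) x).toRingHom y) (Z : Finset L) :
    ∃ δ : MvPolynomial σ F, δ ≠ 0 ∧ ∃ S : Subalgebra F L, (∀ z ∈ Z, z ∈ S) ∧
      ∃ (hxS : ∀ i, x i ∈ S) (hyS : y ∈ S), ∀ (K : Type) [Field K] [Algebra F K],
        ∀ z ∈ points f δ K, ∃ ψ : S →ₐ[F] K, (∀ i, ψ ⟨x i, hxS i⟩ = z.1 i) ∧ ψ ⟨y, hyS⟩ = z.2 := by
  obtain ⟨δ, hδ, hZ⟩ := exists_common_denominator hden Z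
  let T := AdjoinRoot f
  let δT : T := AdjoinRoot.of f δ
  let W := Localization.Away δT
  let ρT : T →ₐ[F] L := AdjoinRoot.liftAlgHom f (aeval x) y ((hdvd f).mpr dvd_rfl)
  have hρT : Function.Injective ρT := by
    rw [injective_iff_map_eq_zero]
    intro t
    induction t using AdjoinRoot.induction_on with
    | ih P => exact fun h => AdjoinRoot.mk_eq_zero.mpr ((hdvd P).mp h)
  have hρof : ∀ r, ρT (AdjoinRoot.of f r) = aeval x r := AdjoinRoot.liftAlgHom_of _ _ _ _
  have hρδ : ρT δT = aeval x δ := hρof δ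
  have hδL : aeval x δ ≠ 0 := (map_ne_zero_iff _ hx).mpr hδ
  have hunit : ∀ {K : Type} [Field K] [Algebra F K] (g : T →ₐ[F] K), g δT ≠ 0 →
      ∀ u : Submonoid.powers δT, IsUnit (g u) := by
    rintro K _ _ g hg ⟨_, n, rfl⟩
    rw [map_pow]
    exact (isUnit_iff_ne_zero.mpr hg).pow n
  let ρ : W →ₐ[F] L := IsLocalization.liftAlgHom (hunit ρT (hρδ ▸ hδL))
  have hρT' : ∀ t, ρ (algebraMap T W t) = ρT t := fun t => IsLocalization.lift_eq _ t
  have hρ : Function.Injective ρ := by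
    rw [injective_iff_map_eq_zero]
    intro w hw
    obtain ⟨t, u, rfl⟩ := IsLocalization.exists_mk'_eq (Submonoid.powers δT) w
    have h1 : ρ (IsLocalization.mk' W t u * algebraMap T W u) = 0 := by rw [map_mul, hw, zero_mul]
    rw [IsLocalization.mk'_spec, hρT'] at h1
    rw [hρT (h1.trans (map_zero ρT).symm), IsLocalization.mk'_zero]
  have hxW : ∀ i, ρ (algebraMap T W (AdjoinRoot.of f (X i))) = x i := fun i => by
    rw [hρT', hρof, aeval_X]
  have hyW : ρ (algebraMap T W (AdjoinRoot.root f)) = y := by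
    rw [hρT']
    exact AdjoinRoot.liftAlgHom_root _ _ _ _
  refine ⟨δ, hδ, ρ.range, fun z hz => ?_, fun i => ⟨_, hxW i⟩, ⟨_, hyW⟩, ?_⟩
  · obtain ⟨P, hP⟩ := hZ z hz
    refine ⟨IsLocalization.mk' W (AdjoinRoot.mk f P) ⟨δT, Submonoid.mem_powers _⟩, ?_⟩
    have h1 := congrArg ρ (IsLocalization.mk'_spec W (AdjoinRoot.mk f P)
      (⟨δT, Submonoid.mem_powers _⟩ : Submonoid.powers δT))
    rw [map_mul, hρT', hρT', hρδ] at h1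
    apply mul_left_cancel₀ hδL
    rw [hP, mul_comm]
    exact h1
  · rintro K _ _ ⟨a, b⟩ ⟨hf, hδK⟩
    let eT : T →ₐ[F] K := AdjoinRoot.liftAlgHom f (aeval a) b hf
    have heof : ∀ r, eT (AdjoinRoot.of f r) = aeval a r := AdjoinRoot.liftAlgHom_of _ _ _ _
    have heδ : eT δT = aeval a δ := heof δ
    let e : W →ₐ[F] K := IsLocalization.liftAlgHom (hunit eT (heδ ▸ hδK))
    have heT : ∀ t, e (algebraMap T W t) = eT t := fun t => IsLocalization.lift_eq _ t
    let ι := AlgEquiv.ofInjective ρ hρ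
    refine ⟨e.comp ι.symm, fun i => ?_, ?_⟩
    · have h1 : (⟨x i, _, hxW i⟩ : ρ.range) = ι (algebraMap T W (AdjoinRoot.of f (X i))) :=
        Subtype.ext (hxW i).symm
      change e (ι.symm ⟨x i, _, hxW i⟩) = _
      rw [h1, AlgEquiv.symm_apply_apply, heT, heof, aeval_X]
    · have h1 : (⟨y, _, hyW⟩ : ρ.range) = ι (algebraMap T W (AdjoinRoot.root f)) :=
        Subtype.ext hyW.symm
      change e (ι.symm ⟨y, _, hyW⟩) = _
      rw [h1, AlgEquiv.symm_apply_apply, heT]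
      exact AdjoinRoot.liftAlgHom_root _ _ _ _

/-- The points of the hypersurface model over a suitable open subset inject into the points of
`Spec A`. -/
theorem exists_points_le_card_algHom [Finite σ] (A : Type) [CommRing A] [IsDomain A] [Algebra F A]
    [Algebra A L] [IsScalarTower F A L] [IsFractionRing A L] [Algebra.FiniteType F A]
    {x : σ → L} (hx : AlgebraicIndependent F x) {y : L} {f : Polynomial (MvPolynomial σ F)}
    (hdvd : ∀ P : Polynomial (MvPolynomial σ F),
      P.eval₂ (aeval (R := F) x).toRingHom y = 0 ↔ f ∣ P)
    (hden : ∀ z : L, ∃ δ : MvPolynomial σ F, δ ≠ 0 ∧ ∃ P : Polynomial (MvPolynomial σ F),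
      aeval x δ * z = P.eval₂ (aeval (R := F) x).toRingHom y) :
    ∃ δ : MvPolynomial σ F, δ ≠ 0 ∧ ∀ (K : Type) [Field K] [Algebra F K] [Finite (A →ₐ[F] K)],
      (points f δ K).ncard ≤ Nat.card (A →ₐ[F] K) := by
  classical
  obtain ⟨G, hG⟩ := Algebra.FiniteType.out (R := F) (A := A)
  obtain ⟨h, hh⟩ := IsLocalization.exist_integer_multiples_of_finite (nonZeroDivisors A)
    (fun o : Option σ => o.elim y x)
  choose α hα using hh
  have hh0 : algebraMap A L h ≠ 0 := (map_ne_zero_iff _ (IsFractionRing.injective A L)).mpr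
    (nonZeroDivisors.ne_zero h.2)
  obtain ⟨δ, hδ, S, hZ, hxS, hyS, hψ⟩ := exists_specialization hx hdvd hden
    (insert (algebraMap A L h)⁻¹ (G.image (algebraMap A L)))
  have hAS : ∀ a : A, IsScalarTower.toAlgHom F A L a ∈ S := by
    have h1 : Algebra.adjoin F (G : Set A) ≤ S.comap (IsScalarTower.toAlgHom F A L) :=
      Algebra.adjoin_le fun a ha =>
        hZ _ (Finset.mem_insert_of_mem (Finset.mem_image_of_mem _ ha))
    exact fun a => h1 (hG ▸ trivial)
  let j : A →ₐ[F] S := (IsScalarTower.toAlgHom F A L).codRestrict S hAS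
  let η : S := ⟨_, hZ _ (Finset.mem_insert_self _ _)⟩
  have hη : j h * η = 1 := Subtype.ext (mul_inv_cancel₀ hh0)
  have hjx : ∀ i, j h * ⟨x i, hxS i⟩ = j (α (some i)) := fun i => Subtype.ext <| by
    refine Eq.trans ?_ (hα (some i)).symm
    exact (Algebra.smul_def (h : A) (x i)).symm
  have hjy : j h * ⟨y, hyS⟩ = j (α none) := Subtype.ext <| by
    refine Eq.trans ?_ (hα none).symm
    exact (Algebra.smul_def (h : A) y).symm
  refine ⟨δ, hδ, fun K _ _ _ => ?_⟩
  choose ψ hψx hψy using hψ K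
  rw [← Nat.card_coe_set_eq]
  refine Nat.card_le_card_of_injective (fun z : points f δ K => (ψ z.1 z.2).comp j) ?_
  rintro ⟨z, hz⟩ ⟨w, hw⟩ hzw
  have hzw' : ∀ a, ψ z hz (j a) = ψ w hw (j a) := fun a => DFunLike.congr_fun hzw a
  have hne : ψ w hw (j h) ≠ 0 := left_ne_zero_of_mul_eq_one (b := ψ w hw η) (by
    rw [← map_mul, hη, map_one])
  refine Subtype.ext (Prod.ext (funext fun i => ?_) ?_)
  · apply mul_left_cancel₀ hne
    change _ * z.1 i = _ * w.1 i
    rw [← hψx w hw i, ← map_mul, hjx, ← hzw', ← hψx z hz i, ← map_mul, hjx, hzw']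
  · apply mul_left_cancel₀ hne
    change _ * z.2 = _ * w.2
    rw [← hψy w hw, ← map_mul, hjy, ← hzw', ← hψy z hz, ← map_mul, hjy, hzw']

end Model

section Dimension

lemma exists_ltSeries_of_isIntegral {R S : Type*} [CommRing R] [CommRing S] [Algebra R S]
    [Algebra.IsIntegral R S] (hinj : Function.Injective (algebraMap R S))
    (p : LTSeries (PrimeSpectrum R)) :
    ∃ q : LTSeries (PrimeSpectrum S), q.length = p.length ∧
      PrimeSpectrum.comap (algebraMap R S) q.last = p.last := by
  induction p using RelSeries.inductionOn' with
  | singleton x =>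
    obtain ⟨Q, -, hQ, hQx⟩ := Ideal.exists_ideal_over_prime_of_isIntegral x.asIdeal (⊥ : Ideal S)
      (by rw [← RingHom.ker_eq_comap_bot, (RingHom.injective_iff_ker_eq_bot _).mp hinj]
          exact bot_le)
    exact ⟨RelSeries.singleton _ ⟨Q, hQ⟩, rfl, PrimeSpectrum.ext hQx⟩
  | snoc p x hx ih =>
    obtain ⟨q, hq, hqp⟩ := ih
    have hlt : p.last < x := hx
    obtain ⟨Q, hle, hQ, hQx⟩ := Ideal.exists_ideal_over_prime_of_isIntegral x.asIdeal
      q.last.asIdeal (by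
        change (PrimeSpectrum.comap (algebraMap R S) q.last).asIdeal ≤ _
        rw [hqp]
        exact hlt.le)
    have hQx' : PrimeSpectrum.comap (algebraMap R S) ⟨Q, hQ⟩ = x := PrimeSpectrum.ext hQx
    have hlt' : q.last < ⟨Q, hQ⟩ := by
      refine lt_of_le_of_ne hle fun h => hlt.ne ?_
      rw [← hqp, ← hQx', h]
    exact ⟨q.snoc ⟨Q, hQ⟩ hlt', by simp [hq], by simp [hQx']⟩

/-- Injective integral ring extensions preserve the Krull dimension. -/
lemma ringKrullDim_eq_of_isIntegral {R S : Type*} [CommRing R] [CommRing S] [Algebra R S]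
    [Algebra.IsIntegral R S] (hinj : Function.Injective (algebraMap R S)) :
    ringKrullDim S = ringKrullDim R := by
  refine le_antisymm ?_ ?_
  · refine Order.krullDim_le_of_strictMono (PrimeSpectrum.comap (algebraMap R S)) fun I J h => ?_
    exact Ideal.IsIntegral.comap_lt_comap (R := R) h
  · refine iSup_le fun p => ?_
    obtain ⟨q, hq, -⟩ := exists_ltSeries_of_isIntegral hinj p
    exact hq ▸ Order.LTSeries.length_le_krullDim q

variable {F A : Type} [Field F] [CommRing A] [Algebra F A] [Algebra.FiniteType F A]

/-- Noether normalization, with the number of variables equal to the dimension. -/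
lemma exists_noether_normalization [Nontrivial A] {d : ℕ} (hd : ringKrullDim A = d) :
    ∃ g : MvPolynomial (Fin d) F →ₐ[F] A, Function.Injective g ∧ g.IsIntegral := by
  obtain ⟨n, g, hg, hint⟩ := exists_integral_inj_algHom_of_fg F A
  let _ : Algebra (MvPolynomial (Fin n) F) A := g.toRingHom.toAlgebra
  have : Algebra.IsIntegral (MvPolynomial (Fin n) F) A := ⟨hint⟩
  have h := ringKrullDim_eq_of_isIntegral (R := MvPolynomial (Fin n) F) (S := A) hg
  rw [hd, MvPolynomial.ringKrullDim_of_isNoetherianRing, ringKrullDim_eq_zero_of_field,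
    Nat.card_eq_fintype_card, Fintype.card_fin, zero_add] at h
  obtain rfl : d = n := by exact_mod_cast h
  exact ⟨g, hg, hint⟩

lemma card_eq_of_isTranscendenceBasis [IsDomain A] {L : Type} [Field L] [Algebra A L]
    [IsFractionRing A L] [Algebra F L] [IsScalarTower F A L] {d : ℕ} (hd : ringKrullDim A = d)
    {s : Finset L} (hs : IsTranscendenceBasis F ((↑) : s → L)) : s.card = d := by
  obtain ⟨g, hg, hint⟩ := exists_noether_normalization (F := F) hd
  let _ : Algebra (MvPolynomial (Fin d) F) A := g.toRingHom.toAlgebra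
  let _ : Algebra (MvPolynomial (Fin d) F) L :=
    ((algebraMap A L).comp g.toRingHom).toAlgebra
  have : IsScalarTower (MvPolynomial (Fin d) F) A L := IsScalarTower.of_algebraMap_eq fun _ => rfl
  have : IsScalarTower F (MvPolynomial (Fin d) F) L := IsScalarTower.of_algebraMap_eq fun r => by
    change _ = algebraMap A L (g (algebraMap _ _ r))
    rw [AlgHom.commutes, ← IsScalarTower.algebraMap_apply]
  have : Algebra.IsIntegral (MvPolynomial (Fin d) F) A := ⟨hint⟩
  have : Algebra.IsAlgebraic A L := IsLocalization.isAlgebraic L (nonZeroDivisors A)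
  have : Algebra.IsAlgebraic (MvPolynomial (Fin d) F) L := Algebra.IsAlgebraic.trans _ A _
  have : FaithfulSMul (MvPolynomial (Fin d) F) L := (faithfulSMul_iff_algebraMap_injective _ _).mpr
    ((IsFractionRing.injective A L).comp hg)
  have h := (IsTranscendenceBasis.mvPolynomial (Fin d) F).algebraMap_comp (A := L)
  simpa using h.cardinalMk_eq hs |>.symm

/-- Upper bound for the number of points, by Noether normalization. -/
theorem exists_card_algHom_le [Nontrivial A] {d : ℕ} (hd : ringKrullDim A = d) :
    ∃ c : ℕ, 0 < c ∧ ∀ (K : Type) [Field K] [Finite K] [Algebra F K],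
      Finite (A →ₐ[F] K) ∧ Nat.card (A →ₐ[F] K) ≤ c * Nat.card K ^ d := by
  classical
  obtain ⟨g, -, hint⟩ := exists_noether_normalization (F := F) hd
  choose P hP hPa using hint
  obtain ⟨G, hG⟩ := Algebra.FiniteType.out (R := F) (A := A)
  have hext : ∀ (K : Type) [Field K] [Algebra F K] (φ ψ : A →ₐ[F] K),
      (∀ a : G, φ a = ψ a) → φ = ψ := fun K _ _ φ ψ h =>
    AlgHom.ext_of_adjoin_eq_top hG fun a ha => h ⟨a, ha⟩
  refine ⟨∏ a : G, (P a).natDegree + 1, Nat.succ_pos _, fun K _ _ _ => ?_⟩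
  have hfin : Finite (A →ₐ[F] K) := Finite.of_injective (fun φ (a : G) => φ a) fun φ ψ h =>
    hext K φ ψ (congrFun h)
  refine ⟨hfin, ?_⟩
  have := Fintype.ofFinite (A →ₐ[F] K)
  have := Fintype.ofFinite K
  let r : (A →ₐ[F] K) → Fin d → K := fun φ i => φ (g (X i))
  have hfib : ∀ v ∈ Finset.univ.image r,
      (Finset.univ.filter fun φ => r φ = v).card ≤ ∏ a : G, (P a).natDegree := by
    intro v _
    let T : G → Finset K := fun a => ((P a).map (aeval (R := F) v).toRingHom).roots.toFinset
    have hT : (Fintype.piFinset T).card ≤ ∏ a : G, (P a).natDegree := by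
      rw [Fintype.card_piFinset]
      refine Finset.prod_le_prod' fun a _ => (Multiset.toFinset_card_le _).trans ?_
      exact (Polynomial.card_roots' _).trans Polynomial.natDegree_map_le
    refine (Finset.card_le_card_of_injOn (fun φ (a : G) => φ a) ?_ ?_).trans hT
    · intro φ hφ
      have hφ' : r φ = v := (Finset.mem_filter.mp hφ).2
      have hcomp : (aeval (R := F) v).toRingHom = (φ : A →+* K).comp g.toRingHom := by
        rw [← hφ']
        ext <;> simp [r]
      refine Finset.mem_coe.mpr (Fintype.mem_piFinset.mpr fun a => ?_)
      rw [Multiset.mem_toFinset, Polynomial.mem_roots ((hP a).map _).ne_zero,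
        Polynomial.IsRoot.def, Polynomial.eval_map, hcomp]
      refine (Polynomial.hom_eval₂ (P a) g.toRingHom (φ : A →+* K) (a : A)).symm.trans ?_
      rw [hPa, map_zero]
    · exact fun φ _ ψ _ h => hext K φ ψ (congrFun h)
  have hcard := Finset.card_le_mul_card_image Finset.univ _ hfib
  rw [Finset.card_univ, ← Nat.card_eq_fintype_card] at hcard
  refine hcard.trans (Nat.mul_le_mul (Nat.le_succ _) ((Finset.card_le_univ _).trans ?_))
  rw [Fintype.card_fun, Fintype.card_fin, Nat.card_eq_fintype_card]

end Dimension

section LowerBound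

variable {F : Type} [Field F]

lemma isDomain_of_isDomain_tensorProduct {A k : Type} [CommRing A] [Algebra F A] [Field k]
    [Algebra F k] [IsDomain (TensorProduct F A k)] : IsDomain A :=
  Function.Injective.isDomain (Algebra.TensorProduct.includeLeft : A →ₐ[F] TensorProduct F A k)
    (Algebra.TensorProduct.includeLeft_injective (S := F) (algebraMap F k).injective)

/-- Lower bound for the number of points, by passing to a birational hypersurface. -/
theorem exists_pow_le_card_algHom [Finite F] (p : ℕ) [Fact p.Prime] [CharP F p]
    {A : Type} [CommRing A] [Algebra F A] [Algebra.FiniteType F A]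
    [IsDomain (TensorProduct F A (AlgebraicClosure F))]
    {d : ℕ} (hd : ringKrullDim A = d) :
    ∃ c s₀ : ℕ, 0 < c ∧ ∀ s ≥ s₀, ∀ (K : Type) [Field K] [Finite K] [Algebra F K]
      [Finite (A →ₐ[F] K)], Nat.card K = p ^ s → (p ^ s) ^ d ≤ c * Nat.card (A →ₐ[F] K) := by
  have : IsDomain A := isDomain_of_isDomain_tensorProduct (F := F) (k := AlgebraicClosure F)
  let L := FractionRing A
  have : IsDomain (TensorProduct F L (AlgebraicClosure F)) :=
    isDomain_tensor_of_isFractionRing F A L (AlgebraicClosure F)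
  have : Algebra.EssFiniteType A L := Algebra.EssFiniteType.of_isLocalization L (nonZeroDivisors A)
  have : Algebra.EssFiniteType F L := Algebra.EssFiniteType.comp F A L
  obtain ⟨s, hs, y, f, hf, hdvd, hden, Δ, hΔ, U, V, hUV⟩ := exists_hypersurface_model F L
  obtain ⟨δ, hδ, hpoints⟩ := exists_points_le_card_algHom A hs.1 hdvd hden
  have hUVδ : (U * Polynomial.C δ) * f + (V * Polynomial.C δ) * f.derivative =
      Polynomial.C (Δ * δ) := by
    rw [Polynomial.C_mul, ← hUV]
    ring
  obtain ⟨c, s₀, hc, h⟩ := exists_pow_le_card_points p hf hdvd (mul_ne_zero hΔ hδ) hUVδ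
  refine ⟨c, s₀, hc, fun t ht K _ _ _ _ hK => ?_⟩
  have hle := h t ht K hK
  rw [Fintype.card_coe, card_eq_of_isTranscendenceBasis hd hs] at hle
  refine hle.trans (Nat.mul_le_mul_left c ((Set.ncard_le_ncard ?_ (Set.toFinite _)).trans
    (hpoints K)))
  rintro z ⟨hz, hz'⟩
  rw [map_mul] at hz'
  exact ⟨hz, right_ne_zero_of_mul hz'⟩

end LowerBound

end LangWeil

/-- Lang–Weil for affine geometrically integral varieties: if `A` is a nonzero finitely
generated algebra over the finite field `F_q` such that `A ⊗_{F_q} F̄_q` is a domain, and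
`d` is the Krull dimension of `A`, then for every finite extension `K/F_q` the set of
`F_q`-algebra homomorphisms `A → K` is finite, and its cardinality for `[K : F_q] = n`
grows like `q^{n d}` for `n` large. -/
theorem langWeil_affine_geometrically_integral
    (q : ℕ) (Fq : Type) [Field Fq] [Fintype Fq] (hq : Fintype.card Fq = q)
    (A : Type) [CommRing A] [Nontrivial A] [Algebra Fq A]
    [Algebra.FiniteType Fq A]
    [IsDomain (TensorProduct Fq A (AlgebraicClosure Fq))]
    (d : ℕ) (hd : ringKrullDim A = d) :
    (∀ (K : Type) [Field K] [Algebra Fq K], FiniteDimensional Fq K →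
        Finite (A →ₐ[Fq] K)) ∧
    ∃ C₁ C₂ : ℝ, 0 < C₁ ∧ 0 < C₂ ∧ ∃ N : ℕ, ∀ n : ℕ, N ≤ n →
      ∀ (K : Type) [Field K] [Algebra Fq K], FiniteDimensional Fq K →
        Module.finrank Fq K = n →
          C₁ * (q : ℝ) ^ (n * d) ≤ (Nat.card (A →ₐ[Fq] K) : ℝ) ∧
          (Nat.card (A →ₐ[Fq] K) : ℝ) ≤ C₂ * (q : ℝ) ^ (n * d) := by
  have hq' : Nat.card Fq = q := Nat.card_eq_fintype_card.trans hq
  obtain ⟨c₂, hc₂, hupper⟩ := LangWeil.exists_card_algHom_le (F := Fq) hd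
  obtain ⟨e, hp, he⟩ := FiniteField.card Fq (ringChar Fq)
  have : Fact (ringChar Fq).Prime := ⟨hp⟩
  obtain ⟨c₁, s₀, hc₁, hlower⟩ :=
    LangWeil.exists_pow_le_card_algHom (F := Fq) (ringChar Fq) hd
  refine ⟨fun K _ _ _ => ?_, (c₁ : ℝ)⁻¹, c₂, by positivity, by positivity, s₀,
    fun n hn K _ _ _ hdeg => ?_⟩
  · have : Finite K := Module.finite_of_finite Fq
    exact (hupper K).1
  have : Finite K := Module.finite_of_finite Fq
  obtain ⟨hfin, hle⟩ := hupper K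
  have hK : Nat.card K = q ^ n := by
    rw [Module.natCard_eq_pow_finrank (K := Fq), hq', hdeg]
  have hKp : Nat.card K = ringChar Fq ^ ((e : ℕ) * n) := by
    rw [hK, ← hq, he, pow_mul]
  have hge := hlower _ (hn.trans (Nat.le_mul_of_pos_left n e.pos)) K hKp
  rw [← hKp, hK, ← pow_mul] at hge
  rw [hK, ← pow_mul] at hle
  refine ⟨?_, by exact_mod_cast hle⟩
  rw [inv_mul_le_iff₀ (by positivity)]
  exact_mod_cast hge
end

section
/- Let p be a prime, let k be an algebraically closed field of characteristic p, let L be the fraction field of the ring W(k) of p-typical Witt vectors of k, and let σ : L → L be the field automorphism induced by the Witt vector Frobenius of W(k). Let n ≥ 1 and d ≥ 1 be integers and let g ∈ GL_n(L). Then g is σ^d-conjugate to σ(g): there exists h ∈ GL_n(L) such that σ(g) = h · g · σ^d(h)⁻¹, where σ acts on matrices entrywise. (This is the claim in the paper's Example on isocrystals with unramified field action, used to show that the associated σ^d-isocrystal is independent of the chosen embedding; it holds because every σ^d-conjugacy class contains a σ-stable element.) -/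
section FrobeniusConjugacy

open Finset Polynomial

section AdditivePolynomials

variable {k : Type*} [Field k] [IsAlgClosed k] {Q : ℕ}

theorem exists_sum_mul_pow_pow_eq (hQ : 1 < Q) (D : ℕ → k) {N i : ℕ} (hi : i < N)
    (hD : D i ≠ 0) (c : k) : ∃ x, ∑ j ∈ range N, D j * x ^ Q ^ j = c := by
  set P : k[X] := ∑ j ∈ range N, C (D j) * X ^ Q ^ j - C c with hP
  have hcoeff : P.coeff (Q ^ i) = D i := by
    have h1 : Q ^ i ≠ 0 := by positivity
    simp only [hP, coeff_sub, finsetSum_coeff, coeff_C_mul, coeff_X_pow, coeff_C, h1, if_false,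
      (Nat.pow_right_injective hQ).eq_iff, mul_ite, mul_one, mul_zero, sub_zero]
    simp [hi]
  have hdeg : P.degree ≠ 0 := by
    intro h
    rw [eq_C_of_degree_eq_zero h, coeff_C, if_neg (by positivity)] at hcoeff
    exact hD hcoeff.symm
  obtain ⟨x, hx⟩ := IsAlgClosed.exists_root P hdeg
  refine ⟨x, ?_⟩
  simpa [hP, IsRoot, eval_finsetSum, sub_eq_zero] using hx

theorem exists_ne_zero_sum_mul_pow_pow_eq_zero (hQ : 1 < Q) (D : ℕ → k) {N i : ℕ} (hi : i < N)
    (hi0 : i ≠ 0) (hD0 : D 0 ≠ 0) (hD : D i ≠ 0) :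
    ∃ x, x ≠ 0 ∧ ∑ j ∈ range N, D j * x ^ Q ^ j = 0 := by
  have hpos (j : ℕ) : 0 < Q ^ j := by positivity
  have hinj (a b : ℕ) : Q ^ a - 1 = Q ^ b - 1 ↔ a = b := by
    have hab : Q ^ a = Q ^ b ↔ a = b := (Nat.pow_right_injective hQ).eq_iff
    have := hpos a
    have := hpos b
    omega
  set P : k[X] := ∑ j ∈ range N, C (D j) * X ^ (Q ^ j - 1) with hP
  have hcoeff (a : ℕ) (ha : a < N) : P.coeff (Q ^ a - 1) = D a := by
    simp only [hP, finsetSum_coeff, coeff_C_mul, coeff_X_pow, hinj, mul_ite, mul_one, mul_zero]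
    simp [ha]
  have hdeg : P.degree ≠ 0 := by
    intro h
    have h1 := hcoeff i hi
    have : 1 < Q ^ i := Nat.one_lt_pow hi0 hQ
    rw [eq_C_of_degree_eq_zero h, coeff_C, if_neg (by omega)] at h1
    exact hD h1.symm
  obtain ⟨x, hx⟩ := IsAlgClosed.exists_root P hdeg
  refine ⟨x, ?_, ?_⟩
  · rintro rfl
    have h0 := hcoeff 0 (by omega)
    rw [pow_zero, Nat.sub_self, coeff_zero_eq_eval_zero, hx.eq_zero] at h0
    exact hD0 h0.symm
  · have hx' : ∑ j ∈ range N, D j * x ^ (Q ^ j - 1) = 0 := by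
      simpa [hP, IsRoot, eval_finsetSum] using hx
    calc _ = (∑ j ∈ range N, D j * x ^ (Q ^ j - 1)) * x := by
          rw [sum_mul]
          refine sum_congr rfl fun j _ ↦ ?_
          rw [mul_assoc, ← pow_succ, Nat.sub_add_cancel (hpos j)]
      _ = 0 := by rw [hx', zero_mul]

end AdditivePolynomials

/-- An endomorphism `frob` of a ring `R`, complete for the topology defined by a power of `unif`,
which fixes `unif` and lifts the `Q`-th power map along a surjection `R → k` whose kernel is
generated by `unif`. -/
structure FrobeniusLift (k R : Type*) [Field k] [CommRing R] (Q : ℕ) where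
  res : R →+* k
  res_surjective : Function.Surjective res
  unif : R
  unif_dvd : ∀ x, res x = 0 → unif ∣ x
  res_unif : res unif = 0
  frob : R →+* R
  frob_unif : frob unif = unif
  res_frob : ∀ x, res (frob x) = res x ^ Q
  ram : ℕ
  exists_sum : ∀ x : ℕ → R, ∃ S, ∀ n, (unif ^ ram) ^ n ∣ S - ∑ i ∈ range n, (unif ^ ram) ^ i * x i
  separated : ∀ x : R, (∀ n, (unif ^ ram) ^ n ∣ x) → x = 0

section TwistedPolynomials

/-- The additive map `∑ i < N, D i * τ ^ i` attached to a ring endomorphism `τ`. -/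
def twistedEval {R : Type*} [CommRing R] (τ : R →+* R) (D : ℕ → R) (N : ℕ) : R →+ R where
  toFun x := ∑ i ∈ range N, D i * τ^[i] x
  map_zero' := by simp [iterate_map_zero]
  map_add' x y := by simp [iterate_map_add, mul_add, sum_add_distrib]

theorem twistedEval_apply {R : Type*} [CommRing R] (τ : R →+* R) (D : ℕ → R) (N : ℕ) (x : R) :
    twistedEval τ D N x = ∑ i ∈ range N, D i * τ^[i] x := rfl

theorem twistedEval_mul_of_fixed {R : Type*} [CommRing R] (τ : R →+* R) (D : ℕ → R) (N : ℕ)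
    {a : R} (ha : τ a = a) (x : R) : twistedEval τ D N (a * x) = a * twistedEval τ D N x := by
  simp only [twistedEval_apply, mul_sum]
  refine sum_congr rfl fun i _ ↦ ?_
  rw [iterate_map_mul, Function.iterate_fixed ha]
  ring

namespace FrobeniusLift

variable {k R : Type*} [Field k] [CommRing R] {Q : ℕ} (Φ : FrobeniusLift k R Q)

theorem surjective_of_forall_dvd (f : R →+ R) {q : R} (hf : ∀ x, f (q * x) = q * f x)
    (hsum : ∀ x : ℕ → R, ∃ S, ∀ n, q ^ n ∣ S - ∑ i ∈ range n, q ^ i * x i)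
    (hsep : ∀ x : R, (∀ n, q ^ n ∣ x) → x = 0) (h : ∀ c, ∃ x, q ∣ f x - c) :
    Function.Surjective f := by
  have hf' (n : ℕ) (x : R) : f (q ^ n * x) = q ^ n * f x := by
    induction n with
    | zero => simp
    | succ n ih => rw [pow_succ', mul_assoc, hf, ih, mul_assoc]
  choose g hg using h
  choose r hr using hg
  intro c
  let cs (n : ℕ) : R := (fun b ↦ -r b)^[n] c
  have key (n : ℕ) : f (∑ i ∈ range n, q ^ i * g (cs i)) = c - q ^ n * cs n := by
    induction n with
    | zero => simp [cs]
    | succ n ih =>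
      have h1 : cs (n + 1) = -r (cs n) := Function.iterate_succ_apply' _ _ _
      have h2 := hr (cs n)
      rw [sum_range_succ, map_add, ih, hf', h1]
      linear_combination q ^ n * h2
  obtain ⟨S, hS⟩ := hsum fun i ↦ g (cs i)
  refine ⟨S, sub_eq_zero.mp <| hsep _ fun n ↦ ?_⟩
  obtain ⟨z, hz⟩ := hS n
  have : f S = q ^ n * f z + (c - q ^ n * cs n) := by
    rw [← key, ← hf', ← hz, ← map_add, sub_add_cancel]
  exact ⟨f z - cs n, by rw [this]; ring⟩

theorem res_iterate_frob (i : ℕ) (x : R) : Φ.res (Φ.frob^[i] x) = Φ.res x ^ Q ^ i := by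
  induction i with
  | zero => simp
  | succ i ih => rw [Function.iterate_succ_apply', Φ.res_frob, ih, ← pow_mul, pow_succ]

theorem res_twistedEval (D : ℕ → R) (N : ℕ) (x : R) :
    Φ.res (twistedEval Φ.frob D N x) = ∑ i ∈ range N, Φ.res (D i) * Φ.res x ^ Q ^ i := by
  simp [twistedEval_apply, res_iterate_frob]

variable [IsAlgClosed k]

theorem twistedEval_surjective (hQ : 1 < Q) (D : ℕ → R) {N i : ℕ} (hi : i < N)
    (hD : Φ.res (D i) ≠ 0) : Function.Surjective (twistedEval Φ.frob D N) := by
  have hmod (c : R) : ∃ x, Φ.unif ∣ twistedEval Φ.frob D N x - c := by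
    obtain ⟨x, hx⟩ := exists_sum_mul_pow_pow_eq hQ (fun j ↦ Φ.res (D j)) hi hD (Φ.res c)
    obtain ⟨x, rfl⟩ := Φ.res_surjective x
    exact ⟨x, Φ.unif_dvd _ <| by rw [map_sub, res_twistedEval, hx, sub_self]⟩
  have hfix (n : ℕ) : Φ.frob (Φ.unif ^ n) = Φ.unif ^ n := by rw [map_pow, Φ.frob_unif]
  have hpow (n : ℕ) (c : R) : ∃ x, Φ.unif ^ n ∣ twistedEval Φ.frob D N x - c := by
    induction n with
    | zero => exact ⟨0, by simp⟩
    | succ n ih =>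
      obtain ⟨x, z, hz⟩ := ih
      obtain ⟨y, w, hw⟩ := hmod z
      refine ⟨x - Φ.unif ^ n * y, -w, ?_⟩
      rw [map_sub, twistedEval_mul_of_fixed _ _ _ (hfix n)]
      linear_combination hz - Φ.unif ^ n * hw
  exact surjective_of_forall_dvd _ (twistedEval_mul_of_fixed _ _ _ (hfix Φ.ram)) Φ.exists_sum
    Φ.separated (hpow Φ.ram)

theorem exists_twistedEval_eq_zero (hQ : 1 < Q) (D : ℕ → R) {N i : ℕ} (hi : i < N) (hi0 : i ≠ 0)
    (hD0 : Φ.res (D 0) ≠ 0) (hD : Φ.res (D i) ≠ 0) :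
    ∃ x, Φ.res x ≠ 0 ∧ twistedEval Φ.frob D N x = 0 := by
  obtain ⟨x, hx0, hx⟩ :=
    exists_ne_zero_sum_mul_pow_pow_eq_zero hQ (fun j ↦ Φ.res (D j)) hi hi0 hD0 hD
  obtain ⟨x, rfl⟩ := Φ.res_surjective x
  obtain ⟨w, hw⟩ := Φ.unif_dvd (twistedEval Φ.frob D N x) <| by rw [res_twistedEval, hx]
  obtain ⟨z, hz⟩ := Φ.twistedEval_surjective hQ D hi hD w
  refine ⟨x - Φ.unif * z, by simpa [Φ.res_unif] using hx0, ?_⟩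
  rw [map_sub, twistedEval_mul_of_fixed _ _ _ Φ.frob_unif, hz, hw, sub_self]

end FrobeniusLift

end TwistedPolynomials

section EisensteinExtension

namespace FrobeniusLift

variable {k R : Type*} [Field k] [CommRing R] {Q : ℕ} (Φ : FrobeniusLift k R Q)

theorem monic_X_pow_sub_C_unif {s : ℕ} (hs : s ≠ 0) : (X ^ s - C Φ.unif).Monic :=
  monic_X_pow_sub_C _ hs

/-- The coefficient of `ϖ ^ i` of an element of `R[ϖ]`, where `ϖ ^ s` is the uniformizer of `R`. -/
noncomputable def rootCoeff {s : ℕ} (hs : s ≠ 0) (i : ℕ) :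
    AdjoinRoot (X ^ s - C Φ.unif) →ₗ[R] R :=
  lcoeff R i ∘ₗ AdjoinRoot.modByMonicHom (Φ.monic_X_pow_sub_C_unif hs)

theorem rootCoeff_apply {s : ℕ} (hs : s ≠ 0) (i : ℕ) (x : AdjoinRoot (X ^ s - C Φ.unif)) :
    Φ.rootCoeff hs i x = (AdjoinRoot.modByMonicHom (Φ.monic_X_pow_sub_C_unif hs) x).coeff i := rfl

theorem root_pow (s : ℕ) :
    AdjoinRoot.root (X ^ s - C Φ.unif) ^ s = AdjoinRoot.of (X ^ s - C Φ.unif) Φ.unif := by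
  have h := AdjoinRoot.eval₂_root (X ^ s - C Φ.unif)
  simpa [sub_eq_zero] using h

theorem sum_rootCoeff [Nontrivial R] {s : ℕ} (hs : s ≠ 0) (x : AdjoinRoot (X ^ s - C Φ.unif)) :
    ∑ i ∈ range s, AdjoinRoot.of _ (Φ.rootCoeff hs i x) * AdjoinRoot.root _ ^ i = x := by
  have hm := Φ.monic_X_pow_sub_C_unif hs
  have hdeg : (AdjoinRoot.modByMonicHom hm x).natDegree < s := by
    obtain ⟨g, rfl⟩ := AdjoinRoot.mk_surjective x
    rw [AdjoinRoot.modByMonicHom_mk]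
    refine (natDegree_modByMonic_lt _ hm fun h ↦ ?_).trans_eq natDegree_X_pow_sub_C
    have := congrArg natDegree h
    rw [natDegree_X_pow_sub_C, natDegree_one] at this
    exact hs this
  conv_rhs => rw [← AdjoinRoot.mk_leftInverse hm x, as_sum_range_C_mul_X_pow' _ hdeg]
  simp [rootCoeff_apply]

/-- The extension of `Φ.res` which kills `ϖ`. -/
noncomputable def rootRes {s : ℕ} (hs : s ≠ 0) : AdjoinRoot (X ^ s - C Φ.unif) →+* k :=
  AdjoinRoot.lift Φ.res 0 (by simp [hs, Φ.res_unif])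

theorem rootRes_of {s : ℕ} (hs : s ≠ 0) (x : R) :
    Φ.rootRes hs (AdjoinRoot.of _ x) = Φ.res x := by
  simp [rootRes]

/-- The extension of `Φ.frob` which fixes `ϖ`. -/
noncomputable def rootFrob (s : ℕ) :
    AdjoinRoot (X ^ s - C Φ.unif) →+* AdjoinRoot (X ^ s - C Φ.unif) :=
  AdjoinRoot.map Φ.frob _ _ (by simp [Polynomial.map_sub, Φ.frob_unif])

theorem res_rootCoeff_zero [Nontrivial R] {s : ℕ} (hs : s ≠ 0)
    (x : AdjoinRoot (X ^ s - C Φ.unif)) :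
    Φ.res (Φ.rootCoeff hs 0 x) = Φ.rootRes hs x := by
  conv_rhs => rw [← Φ.sum_rootCoeff hs x]
  rw [map_sum, sum_eq_single_of_mem 0 (mem_range.mpr (Nat.pos_of_ne_zero hs))]
  · simp [rootRes]
  · intro i _ hi
    simp [rootRes, hi]

theorem rootCoeff_rootFrob {s : ℕ} (hs : s ≠ 0) (i : ℕ) (x : AdjoinRoot (X ^ s - C Φ.unif)) :
    Φ.rootCoeff hs i (Φ.rootFrob s x) = Φ.frob (Φ.rootCoeff hs i x) := by
  obtain ⟨g, rfl⟩ := AdjoinRoot.mk_surjective x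
  have h : Φ.rootFrob s (AdjoinRoot.mk _ g) = AdjoinRoot.mk _ (g.map Φ.frob) := by
    simp [rootFrob, AdjoinRoot.map, AdjoinRoot.lift_mk, ← Polynomial.eval₂_map]
    exact AdjoinRoot.aeval_eq _
  rw [h, rootCoeff_apply, rootCoeff_apply, AdjoinRoot.modByMonicHom_mk,
    AdjoinRoot.modByMonicHom_mk, ← coeff_map, map_modByMonic _ (Φ.monic_X_pow_sub_C_unif hs)]
  simp [Polynomial.map_sub, Φ.frob_unif]

/-- The extension of a `FrobeniusLift` to the ring obtained by adjoining an `s`-th root of the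
uniformizer. -/
noncomputable def adjoinRoot [Nontrivial R] (hram : Φ.ram = 1) {s : ℕ} (hs : s ≠ 0) :
    FrobeniusLift k (AdjoinRoot (X ^ s - C Φ.unif)) Q where
  res := Φ.rootRes hs
  res_surjective y := by
    obtain ⟨x, rfl⟩ := Φ.res_surjective y
    exact ⟨AdjoinRoot.of _ x, by simp [rootRes]⟩
  unif := AdjoinRoot.root _
  unif_dvd x hx := by
    rw [← Φ.res_rootCoeff_zero] at hx
    rw [← Φ.sum_rootCoeff hs x]
    refine dvd_sum fun i _ ↦ ?_
    rcases eq_or_ne i 0 with rfl | hi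
    · have h := _root_.map_dvd (AdjoinRoot.of (X ^ s - C Φ.unif)) (Φ.unif_dvd _ hx)
      rw [← Φ.root_pow] at h
      exact ((dvd_pow_self _ hs).trans h).mul_right _
    · exact (dvd_pow_self _ hi).mul_left _
  res_unif := by simp [rootRes]
  frob := Φ.rootFrob s
  frob_unif := by simp [rootFrob]
  res_frob x := by
    rw [← Φ.res_rootCoeff_zero, ← Φ.res_rootCoeff_zero, rootCoeff_rootFrob, Φ.res_frob]
  ram := s
  exists_sum x := by
    have h := Φ.exists_sum
    simp only [hram, pow_one] at h
    choose S hS using fun i ↦ h fun n ↦ Φ.rootCoeff hs i (x n)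
    refine ⟨∑ i ∈ range s, AdjoinRoot.of _ (S i) * AdjoinRoot.root _ ^ i, fun n ↦ ?_⟩
    rw [Φ.root_pow]
    have h1 : ∑ j ∈ range n, AdjoinRoot.of (X ^ s - C Φ.unif) Φ.unif ^ j * x j =
        ∑ i ∈ range s, AdjoinRoot.of (X ^ s - C Φ.unif)
          (∑ j ∈ range n, Φ.unif ^ j * Φ.rootCoeff hs i (x j)) * AdjoinRoot.root _ ^ i := by
      simp_rw [map_sum, sum_mul]
      rw [sum_comm]
      refine sum_congr rfl fun j _ ↦ ?_
      conv_lhs => rw [← Φ.sum_rootCoeff hs (x j), mul_sum]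
      simp [mul_assoc]
    rw [h1, ← sum_sub_distrib]
    refine dvd_sum fun i _ ↦ ?_
    rw [← sub_mul, ← map_sub, ← map_pow]
    exact (_root_.map_dvd _ (hS i n)).mul_right _
  separated x hx := by
    rw [← Φ.sum_rootCoeff hs x]
    refine sum_eq_zero fun i _ ↦ ?_
    rw [Φ.separated (Φ.rootCoeff hs i x), map_zero, zero_mul]
    intro n
    rw [hram, pow_one]
    obtain ⟨y, hy⟩ := hx n
    rw [Φ.root_pow, ← map_pow, ← AdjoinRoot.algebraMap_eq, ← Algebra.smul_def] at hy
    rw [hy, map_smul, smul_eq_mul]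
    exact dvd_mul_right _ _

end FrobeniusLift

end EisensteinExtension

section WittVectors

variable (p : ℕ) [Fact p.Prime] (k : Type*) [Field k] [CharP k p] [PerfectRing k p]

/-- The `d`-th power of the Frobenius of the Witt vectors, as a lift of `x ↦ x ^ p ^ d`. -/
noncomputable def WittVector.frobeniusLift (d : ℕ) :
    FrobeniusLift k (WittVector p k) (p ^ d) where
  res := WittVector.constantCoeff
  res_surjective := WittVector.constantCoeff_surjective p
  unif := p
  unif_dvd x hx := by
    rw [← Ideal.mem_span_singleton, WittVector.mem_span_p_iff_coeff_zero_eq_zero]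
    exact hx
  res_unif := by simp
  frob := WittVector.frobenius ^ d
  frob_unif := by simp
  res_frob x := by
    rw [RingHom.coe_pow]
    induction d with
    | zero => simp
    | succ d ih =>
      rw [Function.iterate_succ_apply', pow_succ, pow_mul, ← ih]
      exact WittVector.coeff_frobenius_charP p _ _
  ram := 1
  exists_sum x := by
    have hprec := (WittVector.isAdicCompleteIdealSpanP (p := p) (k := k)).toIsPrecomplete
    simp only [pow_one]
    obtain ⟨S, hS⟩ := hprec.prec' (fun n ↦ ∑ i ∈ range n, (p : WittVector p k) ^ i * x i) (by
      intro m n hmn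
      rw [SModEq.comm, SModEq.sub_mem, ← sum_range_add_sum_Ico _ hmn, add_sub_cancel_left,
        smul_eq_mul, Ideal.mul_top, Ideal.span_singleton_pow, Ideal.mem_span_singleton]
      exact dvd_sum fun i hi ↦ (pow_dvd_pow _ (mem_Ico.mp hi).1).mul_right _)
    refine ⟨S, fun n ↦ ?_⟩
    have := hS n
    rw [SModEq.comm, SModEq.sub_mem, smul_eq_mul, Ideal.mul_top, Ideal.span_singleton_pow,
      Ideal.mem_span_singleton] at this
    exact this
  separated x hx := by
    have hhaus := (WittVector.isAdicCompleteIdealSpanP (p := p) (k := k)).toIsHausdorff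
    simp only [pow_one] at hx
    refine hhaus.haus' x fun n ↦ ?_
    rw [SModEq.zero, smul_eq_mul, Ideal.mul_top, Ideal.span_singleton_pow,
      Ideal.mem_span_singleton]
    exact hx n

end WittVectors

section Semilinear

theorem exists_linearIndependent_and_eq_sum {K V : Type*} [Field K] [AddCommGroup V] [Module K V]
    [FiniteDimensional K V] (v : ℕ → V) : ∃ (m : ℕ) (c : ℕ → K),
      LinearIndependent K (fun i : Fin m ↦ v i) ∧ v m = ∑ i ∈ range m, c i • v i := by
  classical
  have hex : ∃ m, ¬ LinearIndependent K (fun i : Fin m ↦ v i) := by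
    refine ⟨Module.finrank K V + 1, fun h ↦ ?_⟩
    simpa using h.fintype_card_le_finrank
  obtain ⟨m, hm⟩ : ∃ m, Nat.find hex = m + 1 := by
    refine Nat.exists_eq_succ_of_ne_zero fun h ↦ ?_
    have := Nat.find_spec hex
    rw [h] at this
    exact this linearIndependent_empty_type
  have hli : LinearIndependent K (fun i : Fin m ↦ v i) :=
    not_not.mp (Nat.find_min hex (by omega))
  have hdep := Nat.find_spec hex
  rw [hm, linearIndependent_finSucc'] at hdep
  have hmem : v m ∈ Submodule.span K (Set.range fun i : Fin m ↦ v i) := by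
    by_contra h
    exact hdep ⟨hli, by simpa [Fin.init_def] using h⟩
  obtain ⟨c, hc⟩ := (Submodule.mem_span_range_iff_exists_fun K).mp hmem
  refine ⟨m, fun i ↦ if h : i < m then c ⟨i, h⟩ else 0, hli, ?_⟩
  rw [← hc, ← Fin.sum_univ_eq_sum_range
    (fun i ↦ (if h : i < m then c ⟨i, h⟩ else 0 : K) • v i)]
  simp

/-- The coefficients of a vector fixed by a semilinear map in the basis of a cyclic module, with
prescribed last coefficient `y`. -/
def hornerSeq {R : Type*} [CommRing R] (τ : R →+* R) (b : ℕ → R) (e y : R) : ℕ → R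
  | 0 => b 0 * τ y + e
  | j + 1 => τ (hornerSeq τ b e y j) + b (j + 1) * τ y

/-- The coefficients of the twisted polynomial whose zeros are the fixed points of
`y ↦ hornerSeq τ b 0 y j`. -/
def hornerCoeff {R : Type*} [CommRing R] (τ : R →+* R) (b : ℕ → R) (j : ℕ) : ℕ → R
  | 0 => 1
  | l + 1 => -τ^[l] (b (j - l))

theorem hornerSeq_add_twistedEval {R : Type*} [CommRing R] (τ : R →+* R) (b : ℕ → R) (e y : R)
    (j : ℕ) :
    hornerSeq τ b e y j + twistedEval τ (hornerCoeff τ b j) (j + 2) y = y + τ^[j] e := by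
  have h : hornerSeq τ b e y j =
      ∑ l ∈ range (j + 1), τ^[l] (b (j - l)) * τ^[l + 1] y + τ^[j] e := by
    induction j with
    | zero => simp [hornerSeq]
    | succ j ih =>
      rw [hornerSeq, ih, sum_range_succ' _ (j + 1)]
      simp only [map_add, map_sum, map_mul, ← Function.iterate_succ_apply' τ, Nat.add_sub_add_right]
      simp only [Function.iterate_succ_apply', Function.iterate_zero, id, Nat.sub_zero]
      ring
  rw [h, twistedEval_apply, sum_range_succ' _ (j + 1)]
  simp only [hornerCoeff, neg_mul, sum_neg_distrib, Function.iterate_zero, id]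
  ring

variable {K V : Type*} [Field K] [AddCommGroup V] [Module K V] [FiniteDimensional K V]
  {τ : K →+* K}

theorem exists_semilinear_add_eq (T : V →ₛₗ[τ] V)
    (hτ : ∀ (D : ℕ → K) (N : ℕ), D 0 ≠ 0 → 0 < N → Function.Surjective (twistedEval τ D N))
    (x : V) : ∃ u, T u + x = u := by
  obtain ⟨m, c, -, hm⟩ := exists_linearIndependent_and_eq_sum (K := K) fun i ↦ T^[i] x
  rcases m with - | m
  · refine ⟨0, ?_⟩
    simpa using hm
  obtain ⟨y, hy⟩ := hτ (hornerCoeff τ c m) (m + 2) (by simp [hornerCoeff]) (by omega) (τ^[m] 1)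
  have hlast : hornerSeq τ c 1 y m = y := by
    have := hornerSeq_add_twistedEval τ c 1 y m
    rwa [hy, add_left_inj] at this
  refine ⟨∑ j ∈ range (m + 1), hornerSeq τ c 1 y j • T^[j] x, ?_⟩
  have h1 : T (∑ j ∈ range (m + 1), hornerSeq τ c 1 y j • T^[j] x) =
      ∑ j ∈ range (m + 1), τ (hornerSeq τ c 1 y j) • T^[j + 1] x := by
    simp [map_sum, Function.iterate_succ_apply']
  rw [h1, sum_range_succ, hlast, hm, smul_sum, sum_range_succ', sum_range_succ' _ m]
  simp only [hornerSeq, add_smul, sum_add_distrib, smul_smul, mul_comm (c _)]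
  simp
  abel

end Semilinear

section Slopes

/-- The minimal slope `r / s` among the points `(n - i, ν i)` for `i ∈ S`. -/
theorem exists_coprime_slope (ν : ℕ → ℕ) {n : ℕ} {S : Finset ℕ} (hS : S.Nonempty)
    (hSn : ∀ i ∈ S, i < n) : ∃ r s i₀, s ≠ 0 ∧ r.Coprime s ∧ i₀ ∈ S ∧
      r * (n - i₀) = s * ν i₀ ∧ ∀ i ∈ S, r * (n - i) ≤ s * ν i := by
  obtain ⟨i₀, hi₀, hmin⟩ := S.exists_min_image (fun i ↦ (ν i : ℚ) / ((n - i : ℕ) : ℚ)) hS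
  set q : ℚ := (ν i₀ : ℚ) / ((n - i₀ : ℕ) : ℚ) with hq
  have hq0 : 0 ≤ q := by positivity
  have hden : (0 : ℚ) < q.den := by exact_mod_cast q.den_pos
  have hnum : (q.num.natAbs : ℚ) = q * q.den := by
    rw [Rat.mul_den_eq_num, Nat.cast_natAbs, abs_of_nonneg (Rat.num_nonneg.mpr hq0)]
  have hpos (i : ℕ) (hi : i ∈ S) : (0 : ℚ) < ((n - i : ℕ) : ℚ) := by
    have := hSn i hi
    exact_mod_cast (by omega : 0 < n - i)
  refine ⟨q.num.natAbs, q.den, i₀, q.den_ne_zero, q.reduced, hi₀, ?_, fun i hi ↦ ?_⟩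
  · have h1 : q * ((n - i₀ : ℕ) : ℚ) = ν i₀ := div_mul_cancel₀ _ (hpos _ hi₀).ne'
    have : (q.num.natAbs : ℚ) * ((n - i₀ : ℕ) : ℚ) = q.den * ν i₀ := by
      rw [hnum, ← h1]
      ring
    exact_mod_cast this
  · have h1 : q * ((n - i : ℕ) : ℚ) ≤ ν i := (le_div_iff₀ (hpos _ hi)).mp (hmin i hi)
    have : (q.num.natAbs : ℚ) * ((n - i : ℕ) : ℚ) ≤ q.den * ν i := by
      rw [hnum]
      nlinarith
    exact_mod_cast this

namespace FrobeniusLift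

variable {k R L : Type*} [Field k] [IsAlgClosed k] [CommRing R] [Field L] [Algebra R L]
  [FaithfulSMul R L] {Q : ℕ} (Φ : FrobeniusLift k R Q)

variable {V : Type*} [AddCommGroup V] [Module L V] {τ : L →+* L}

/-- A cyclic module whose defining relation has integral coefficients contains an eigenvector of a
power of the semilinear operator. -/
theorem exists_iterate_eq_of_integral_relation (hQ : 1 < Q) (hram : Φ.ram = 1)
    (hfac : ∀ a : R, a ≠ 0 → ∃ (m : ℕ) (w : R), Φ.res w ≠ 0 ∧ a = Φ.unif ^ m * w)
    (hτ : ∀ x, τ (algebraMap R L x) = algebraMap R L (Φ.frob x)) (T : V →ₛₗ[τ] V) (v : V) {n : ℕ}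
    (hli : LinearIndependent L fun i : Fin n ↦ T^[i] v) (a : ℕ → R) {i₁ : ℕ} (hi₁ : i₁ < n)
    (ha : a i₁ ≠ 0) (hrel : T^[n] v = ∑ i ∈ range n, algebraMap R L (a i) • T^[i] v) :
    ∃ (u : V) (r s : ℕ), u ≠ 0 ∧ s ≠ 0 ∧ s ≤ n ∧ T^[s] u = algebraMap R L Φ.unif ^ r • u := by
  classical
  have : Nontrivial R := ⟨a i₁, 0, ha⟩
  choose! ν w hw haw using hfac
  obtain ⟨r, s, i₀, hs, hrs, hi₀, heq, hle⟩ := exists_coprime_slope (fun i ↦ ν (a i))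
    (S := {i ∈ range n | a i ≠ 0}) ⟨i₁, by simp [hi₁, ha]⟩ (n := n) (by simp +contextual)
  simp only [mem_filter, mem_range] at hi₀ hle
  set Ψ := Φ.adjoinRoot hram hs with hΨ
  let ι := AdjoinRoot.of (X ^ s - C Φ.unif)
  have hι : Ψ.unif ^ s = ι Φ.unif := Φ.root_pow s
  let b (i : ℕ) : AdjoinRoot (X ^ s - C Φ.unif) :=
    if a i = 0 then 0 else Ψ.unif ^ (s * ν (a i) - r * (n - i)) * ι (w (a i))
  have hab (i : ℕ) (hi : i < n) : ι (a i) = Ψ.unif ^ (r * (n - i)) * b i := by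
    by_cases h : a i = 0
    · simp [b, h]
    · simp only [b, if_neg h]
      rw [← mul_assoc, ← pow_add, Nat.add_sub_cancel' (hle i ⟨hi, h⟩), pow_mul, hι, ← map_pow,
        ← map_mul, ← haw _ h]
  have hb : Ψ.res (b i₀) ≠ 0 := by
    simp only [b, if_neg hi₀.2, heq, Nat.sub_self, pow_zero, one_mul]
    exact (Φ.rootRes_of hs _).trans_ne (hw _ hi₀.2)
  obtain ⟨m, rfl⟩ : ∃ m, n = m + 1 := Nat.exists_eq_succ_of_ne_zero (by omega)
  obtain ⟨y, hy0, hy⟩ := Ψ.exists_twistedEval_eq_zero hQ (hornerCoeff Ψ.frob b m)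
    (N := m + 2) (i := m - i₀ + 1) (by omega) (by omega) (by simp [hornerCoeff]) (by
      simp [hornerCoeff, res_iterate_frob, Nat.sub_sub_self (Nat.lt_succ_iff.mp hi₀.1), hb])
  have hlast : hornerSeq Ψ.frob b 0 y m = y := by
    have := hornerSeq_add_twistedEval Ψ.frob b 0 y m
    rwa [hy, iterate_map_zero, add_zero, add_zero] at this
  let Y (j : ℕ) := Ψ.unif ^ (r * (m - j)) * hornerSeq Ψ.frob b 0 y j
  have hYm : Y m = y := by simp [Y, hlast]
  have hY0 : Ψ.unif ^ r * Y 0 = ι (a 0) * Ψ.frob y := by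
    rw [hab 0 (by omega)]
    simp only [Y, hornerSeq, Nat.sub_zero]
    ring
  have hY (j : ℕ) (hj : j < m) :
      Ψ.unif ^ r * Y (j + 1) = Ψ.frob (Y j) + ι (a (j + 1)) * Ψ.frob y := by
    rw [hab (j + 1) (by omega)]
    obtain ⟨l, rfl⟩ := Nat.exists_eq_add_of_lt hj
    simp only [Y, hornerSeq, map_mul, map_pow, Ψ.frob_unif]
    rw [show j + l + 1 + 1 - (j + 1) = l + 1 by omega, show j + l + 1 - (j + 1) = l by omega,
      show j + l + 1 - j = l + 1 by omega]
    ring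
  let f (x : AdjoinRoot (X ^ s - C Φ.unif)) : L := algebraMap R L (Φ.rootCoeff hs 0 x)
  have hfadd (x z) : f (x + z) = f x + f z := by simp [f]
  have hfι (x : R) (z) : f (ι x * z) = algebraMap R L x * f z := by
    have : ι x * z = x • z := (Algebra.smul_def x z).symm
    simp [f, this]
  have hfτ (x) : τ (f x) = f (Ψ.frob x) := by
    simp only [f, hτ]
    rw [← Φ.rootCoeff_rootFrob]
    rfl
  let U (x : AdjoinRoot (X ^ s - C Φ.unif)) : V := ∑ j ∈ range (m + 1), f (x * Y j) • T^[j] v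
  have hTU (x) (hx : Ψ.frob x = x) : T (U x) = U (Ψ.unif ^ r * x) := by
    have h1 : T (U x) = ∑ j ∈ range (m + 1), f (x * Ψ.frob (Y j)) • T^[j + 1] v := by
      simp only [U, map_sum, LinearMap.map_smulₛₗ, Function.iterate_succ_apply', hfτ, map_mul, hx]
    have h2 : U (Ψ.unif ^ r * x) = ∑ j ∈ range (m + 1), f (x * (Ψ.unif ^ r * Y j)) • T^[j] v := by
      refine sum_congr rfl fun j _ ↦ ?_
      rw [show Ψ.unif ^ r * x * Y j = x * (Ψ.unif ^ r * Y j) by ring]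
    have h3 (j : ℕ) : x * (ι (a j) * Ψ.frob y) = ι (a j) * (x * Ψ.frob y) := by ring
    rw [h1, h2, sum_range_succ, hrel, hYm, smul_sum, sum_range_succ', sum_range_succ' _ m, hY0, h3,
      hfι]
    have h4 : ∑ j ∈ range m, f (x * (Ψ.unif ^ r * Y (j + 1))) • T^[j + 1] v =
        ∑ j ∈ range m, f (x * Ψ.frob (Y j)) • T^[j + 1] v +
          ∑ j ∈ range m, f (x * Ψ.frob y) • algebraMap R L (a (j + 1)) • T^[j + 1] v := by
      rw [← sum_add_distrib]
      refine sum_congr rfl fun j hj ↦ ?_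
      rw [hY j (mem_range.mp hj), mul_add, hfadd, h3, hfι, add_smul, smul_smul,
        mul_comm (algebraMap R L _)]
    rw [h4, smul_smul, mul_comm (algebraMap R L _)]
    abel
  have hiter (l : ℕ) : T^[l] (U 1) = U (Ψ.unif ^ (r * l)) := by
    induction l with
    | zero => simp
    | succ l ih =>
      rw [Function.iterate_succ_apply', ih, hTU _ (by rw [map_pow, Ψ.frob_unif])]
      ring_nf
  have hsn : s ≤ m + 1 :=
    (Nat.le_of_dvd (by omega) (hrs.symm.dvd_of_dvd_mul_left (heq ▸ dvd_mul_right _ _))).trans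
      (Nat.sub_le _ i₀)
  refine ⟨U 1, r, s, fun h ↦ ?_, hs, hsn, ?_⟩
  · have h1 : ∑ j : Fin (m + 1), f (1 * Y j) • T^[(j : ℕ)] v = 0 := by
      rw [← h]
      exact Fin.sum_univ_eq_sum_range (fun j ↦ f (1 * Y j) • T^[j] v) (m + 1)
    have h2 := Fintype.linearIndependent_iff.mp hli _ h1 (Fin.last m)
    rw [Fin.val_last, hYm, one_mul] at h2
    have h3 : Φ.rootCoeff hs 0 y = 0 := by
      apply FaithfulSMul.algebraMap_injective R L
      rw [map_zero]
      exact h2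
    apply hy0
    have h4 := Φ.res_rootCoeff_zero hs y
    rw [h3, map_zero] at h4
    exact h4.symm
  · rw [hiter, mul_comm r s, pow_mul, hι, ← map_pow ι, ← map_pow (algebraMap R L),
      ← mul_one (ι _)]
    simp only [U, mul_assoc, hfι, smul_sum, smul_smul]

end FrobeniusLift

end Slopes

section IsocrystalEigenvector

namespace WittVector

variable {p : ℕ} [Fact p.Prime] {k : Type*} [Field k] [CharP k p] [PerfectRing k p]
  {L : Type*} [Field L] [Algebra (WittVector p k) L] [IsFractionRing (WittVector p k) L]

theorem natCast_ne_zero_of_fractionRing (p : ℕ) [Fact p.Prime] (k : Type*) [Field k] [CharP k p]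
    [PerfectRing k p] (L : Type*) [Field L] [Algebra (WittVector p k) L]
    [IsFractionRing (WittVector p k) L] : (p : L) ≠ 0 := by
  rw [← map_natCast (algebraMap (WittVector p k) L), Ne, FaithfulSMul.algebraMap_eq_zero_iff]
  exact p_nonzero p k

theorem exists_algebraMap_eq_p_pow_mul (x : L) :
    ∃ (M : ℕ) (a : WittVector p k), algebraMap _ L a = (p : L) ^ M * x := by
  obtain ⟨a, b, hb, rfl⟩ := IsFractionRing.div_surjective (A := WittVector p k) x
  have hb0 : b ≠ 0 := nonZeroDivisors.ne_zero hb
  obtain ⟨M, w, rfl⟩ := exists_eq_pow_p_mul' b hb0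
  refine ⟨M, a * ↑w⁻¹, ?_⟩
  have h1 : algebraMap (WittVector p k) L (w : WittVector p k) *
      algebraMap (WittVector p k) L (↑w⁻¹ : WittVector p k) = 1 := by
    rw [← map_mul, Units.mul_inv, map_one]
  have h2 : algebraMap (WittVector p k) L ((p : WittVector p k) ^ M * w) ≠ 0 := by
    rwa [Ne, FaithfulSMul.algebraMap_eq_zero_iff]
  rw [mul_div_assoc', eq_div_iff h2, map_mul, map_mul, map_pow, map_natCast]
  linear_combination ((p : L) ^ M * algebraMap _ L a) * h1

theorem exists_algebraMap_eq_p_pow_mul_of_lt (c : ℕ → L) (m : ℕ) :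
    ∃ (M : ℕ) (a : ℕ → WittVector p k), ∀ i < m, algebraMap _ L (a i) = (p : L) ^ M * c i := by
  choose M a ha using fun i ↦ exists_algebraMap_eq_p_pow_mul (p := p) (k := k) (c i)
  refine ⟨∑ i ∈ range m, M i, fun i ↦ p ^ (∑ i ∈ range m, M i - M i) * a i, fun i hi ↦ ?_⟩
  have hle : M i ≤ ∑ i ∈ range m, M i :=
    single_le_sum (fun _ _ ↦ Nat.zero_le _) (mem_range.mpr hi)
  rw [map_mul, map_pow, map_natCast, ha, ← mul_assoc, ← pow_add, Nat.sub_add_cancel hle]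

variable [IsAlgClosed k] {d : ℕ} {τ : L →+* L}

theorem twistedEval_surjective_of_fractionRing (hd : d ≠ 0)
    (hτ : ∀ x, τ (algebraMap (WittVector p k) L x) =
      algebraMap _ L ((frobeniusLift p k d).frob x))
    (D : ℕ → L) (N : ℕ) (hD : D 0 ≠ 0) (hN : 0 < N) :
    Function.Surjective (twistedEval τ D N) := by
  have hQ : 1 < p ^ d := Nat.one_lt_pow hd (Fact.out : p.Prime).one_lt
  have hp0 : (p : L) ≠ 0 := natCast_ne_zero_of_fractionRing p k L
  let val := ValuationRing.valuation (WittVector p k) L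
  obtain ⟨i, hi, hmax⟩ := (range N).exists_max_image (fun j ↦ val (D j)) ⟨0, mem_range.mpr hN⟩
  have hi0 : val (D i) ≠ 0 := fun h ↦
    (val.ne_zero_iff.mpr hD) (le_zero_iff.mp (h ▸ hmax 0 (mem_range.mpr hN)))
  have hDi : D i ≠ 0 := val.ne_zero_iff.mp hi0
  have hint (j : ℕ) (hj : j < N) : ∃ a : WittVector p k, algebraMap _ L a = D j / D i := by
    rw [← ValuationRing.mem_integer_iff, Valuation.mem_integer_iff, map_div₀]
    exact div_le_one_of_le₀ (hmax j (mem_range.mpr hj)) zero_le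
  choose! a ha using hint
  have hai : a i = 1 := by
    apply FaithfulSMul.algebraMap_injective (WittVector p k) L
    rw [ha i (mem_range.mp hi), div_self hDi, map_one]
  intro y
  obtain ⟨M, y', hy'⟩ := exists_algebraMap_eq_p_pow_mul (p := p) (k := k) (y / D i)
  obtain ⟨x, hx⟩ := (frobeniusLift p k d).twistedEval_surjective hQ a (mem_range.mp hi)
    (by rw [hai, map_one]; exact one_ne_zero) y'
  have hiter (j : ℕ) : τ^[j] (algebraMap (WittVector p k) L x) =
      algebraMap _ L ((frobeniusLift p k d).frob^[j] x) := by
    induction j with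
    | zero => rfl
    | succ j ih => rw [Function.iterate_succ_apply', ih, hτ, Function.iterate_succ_apply']
  have hev : twistedEval τ D N (algebraMap _ L x) = D i * algebraMap _ L y' := by
    rw [← hx, twistedEval_apply, twistedEval_apply, map_sum, mul_sum]
    refine sum_congr rfl fun j hj ↦ ?_
    rw [hiter, map_mul, ha j (mem_range.mp hj)]
    field_simp
  refine ⟨((p : L) ^ M)⁻¹ * algebraMap _ L x, ?_⟩
  rw [twistedEval_mul_of_fixed _ _ _ (by simp), hev, hy']
  field_simp

theorem exists_linearIndependent_iterate {V : Type*} [AddCommGroup V] [Module L V]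
    [FiniteDimensional L V] [Nontrivial V] (hd : d ≠ 0)
    (hτ : ∀ x, τ (algebraMap (WittVector p k) L x) =
      algebraMap _ L ((frobeniusLift p k d).frob x))
    (T : V →ₛₗ[τ] V) (hT : Function.Injective T) :
    ∃ (u : V) (s : ℕ) (e : ℤ), s ≠ 0 ∧ LinearIndependent L (fun i : Fin s ↦ T^[i] u) ∧
      T^[s] u = (p : L) ^ e • u := by
  classical
  have hQ : 1 < p ^ d := Nat.one_lt_pow hd (Fact.out : p.Prime).one_lt
  have hp0 : (p : L) ≠ 0 := natCast_ne_zero_of_fractionRing p k L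
  let cyclic (m : ℕ) (v : V) : Prop := v ≠ 0 ∧ ∃ c : ℕ → L,
    LinearIndependent L (fun i : Fin m ↦ T^[i] v) ∧ T^[m] v = ∑ i ∈ range m, c i • T^[i] v
  have hcyc (v : V) (hv : v ≠ 0) : ∃ m, cyclic m v := by
    obtain ⟨m, c, h⟩ := exists_linearIndependent_and_eq_sum (K := L) fun i ↦ T^[i] v
    exact ⟨m, hv, c, h⟩
  have hex : ∃ m v, cyclic m v := by
    obtain ⟨v, hv⟩ := exists_ne (0 : V)
    obtain ⟨m, hm⟩ := hcyc v hv
    exact ⟨m, v, hm⟩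
  set m := Nat.find hex
  obtain ⟨v, hv, c, hli, hrel⟩ := Nat.find_spec hex
  obtain ⟨i₁, hi₁, hc⟩ : ∃ i < m, c i ≠ 0 := by
    by_contra! h
    rw [sum_eq_zero fun i hi ↦ by rw [h i (mem_range.mp hi), zero_smul],
      ← iterate_map_zero T m] at hrel
    exact hv (hT.iterate m hrel)
  obtain ⟨M, a, ha⟩ := exists_algebraMap_eq_p_pow_mul_of_lt (p := p) (k := k) c m
  have hτp (j : ℕ) : τ ((p : L) ^ j) = (p : L) ^ j := by simp
  have hiter (j : ℕ) (w : V) : ((p : L) ^ M • T)^[j] w = (p : L) ^ (M * j) • T^[j] w := by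
    induction j with
    | zero => simp
    | succ j ih =>
      rw [Function.iterate_succ_apply', ih, LinearMap.smul_apply, LinearMap.map_smulₛₗ, hτp,
        smul_smul, Function.iterate_succ_apply', ← pow_add]
      ring_nf
  obtain ⟨u, r, s, hu, hs, hsm, hTu⟩ :=
    (frobeniusLift p k d).exists_iterate_eq_of_integral_relation hQ rfl
      (fun a ha ↦ exists_eq_pow_p_mul a ha) hτ ((p : L) ^ M • T) v (n := m)
      (by
        simp only [hiter]
        exact hli.units_smul fun i ↦ Units.mk0 _ (pow_ne_zero (M * i) hp0))
      (fun i ↦ p ^ (M * (m - 1 - i)) * a i) hi₁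
      (by
        refine mul_ne_zero (pow_ne_zero _ (p_nonzero p k)) fun h ↦ ?_
        have := ha i₁ hi₁
        rw [h, map_zero, eq_comm] at this
        exact mul_ne_zero (pow_ne_zero _ hp0) hc this)
      (by
        simp only [hiter]
        rw [hrel, smul_sum]
        refine sum_congr rfl fun i hi ↦ ?_
        have hi := mem_range.mp hi
        rw [smul_smul, smul_smul, map_mul, ha i hi, map_pow, map_natCast]
        congr 1
        obtain ⟨l, hl⟩ := Nat.exists_eq_add_of_lt hi
        rw [hl, show i + l + 1 - 1 - i = l by omega]
        ring)
  have hTu' : T^[s] u = (p : L) ^ ((r : ℤ) - (M * s : ℕ)) • u := by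
    rw [hiter, show (frobeniusLift p k d).unif = (p : WittVector p k) from rfl, map_natCast] at hTu
    rw [zpow_sub₀ hp0, zpow_natCast, zpow_natCast, div_eq_inv_mul, mul_smul, ← hTu, smul_smul,
      inv_mul_cancel₀ (pow_ne_zero _ hp0), one_smul]
  obtain ⟨m', -, c', hli', hrel'⟩ := hcyc u hu
  have hmm' : m ≤ m' := Nat.find_min' hex ⟨u, hu, c', hli', hrel'⟩
  have hsm' : m' ≤ s := by
    by_contra! h
    have hinj : Function.Injective ![(⟨0, by omega⟩ : Fin m'), ⟨s, h⟩] := by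
      rw [Function.Injective, Fin.forall_fin_two]
      simp [Fin.forall_fin_two, hs, hs.symm]
    have hpair : LinearIndependent L ![u, T^[s] u] := by
      convert hli'.comp _ hinj using 1
      ext i
      fin_cases i <;> rfl
    have := LinearIndependent.pair_iff.mp hpair (-(p : L) ^ ((r : ℤ) - (M * s : ℕ))) 1
      (by rw [hTu']; module)
    exact one_ne_zero this.2
  obtain rfl : s = m' := by omega
  exact ⟨u, s, _, hs, hli', hTu'⟩

end WittVector

end IsocrystalEigenvector

section StableBasis

section

variable {K V : Type*} [Field K] [AddCommGroup V] [Module K V] {τ : K →+* K}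
  {ι : Type*} [Fintype ι]

theorem Module.Basis.span_range_semilinear_eq_top (b : Module.Basis ι K V) (T : V →ₛₗ[τ] V)
    (hT : Submodule.span K (Set.range T) = ⊤) :
    Submodule.span K (Set.range (T ∘ b)) = ⊤ := by
  rw [eq_top_iff, ← hT, Submodule.span_le]
  rintro _ ⟨x, rfl⟩
  rw [← b.sum_repr x, map_sum]
  refine Submodule.sum_mem _ fun i _ ↦ ?_
  rw [LinearMap.map_smulₛₗ]
  exact Submodule.smul_mem _ _ (Submodule.subset_span ⟨i, rfl⟩)

theorem Module.Basis.linearIndependent_semilinear (b : Module.Basis ι K V) (T : V →ₛₗ[τ] V)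
    (hT : Submodule.span K (Set.range T) = ⊤) : LinearIndependent K (T ∘ b) :=
  linearIndependent_of_top_le_span_of_card_eq_finrank
    (b.span_range_semilinear_eq_top T hT).ge (Module.finrank_eq_card_basis b).symm

theorem exists_mul_eq_one_of_span_range_eq_top [DecidableEq ι] (b : Module.Basis ι K V)
    (T : V →ₛₗ[τ] V) (hT : Submodule.span K (Set.range T) = ⊤) (A : Matrix ι ι K)
    (hA : ∀ j, T (b j) = ∑ i, A i j • b i) : ∃ E, E * A = 1 := by
  let b' := Module.Basis.mk (b.linearIndependent_semilinear T hT)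
    (b.span_range_semilinear_eq_top T hT).ge
  have h : A = b.toMatrix b' := by
    ext i j
    simp [b', Module.Basis.toMatrix_apply, hA, Finsupp.single_apply]
  exact ⟨b'.toMatrix b, h ▸ b'.toMatrix_mul_toMatrix_flip b⟩

variable [FiniteDimensional K V]

theorem LinearMap.injective_of_span_range_eq_top (T : V →ₛₗ[τ] V)
    (hT : Submodule.span K (Set.range T) = ⊤) : Function.Injective T := by
  let b := Module.finBasis K V
  have hli := Fintype.linearIndependent_iff.mp (b.linearIndependent_semilinear T hT)
  rw [injective_iff_map_eq_zero]
  intro x hx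
  rw [← b.sum_repr x, map_sum] at hx
  simp only [LinearMap.map_smulₛₗ] at hx
  refine b.ext_elem fun i ↦ ?_
  simpa using hli _ hx i

end

namespace WittVector

variable {p : ℕ} [Fact p.Prime] {k : Type*} [Field k] [CharP k p] [PerfectRing k p] [IsAlgClosed k]
  {L : Type*} [Field L] [Algebra (WittVector p k) L] [IsFractionRing (WittVector p k) L]
  {d : ℕ} {τ : L →+* L}

/-- A semilinear operator of Frobenius type whose image spans has a matrix fixed by every
endomorphism of the field of scalars. -/
theorem exists_basis_fixed_matrix (hd : d ≠ 0)
    (hτ : ∀ x, τ (algebraMap (WittVector p k) L x) =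
      algebraMap _ L ((frobeniusLift p k d).frob x)) (σ : L →+* L) (n : ℕ)
    {V : Type*} [AddCommGroup V] [Module L V] [FiniteDimensional L V]
    (hV : Module.finrank L V = n) (T : V →ₛₗ[τ] V)
    (hT : Submodule.span L (Set.range T) = ⊤) :
    ∃ (ι : Type) (_ : Fintype ι) (b : Module.Basis ι L V) (A : Matrix ι ι L),
      A.map σ = A ∧ ∀ j, T (b j) = ∑ i, A i j • b i := by
  classical
  induction n using Nat.strong_induction_on generalizing V with
  | _ n ih =>
  rcases n.eq_zero_or_pos with rfl | hn
  · have := Module.finrank_zero_iff.mp hV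
    exact ⟨Empty, inferInstance, Module.Basis.empty V, 0, by simp, by simp⟩
  have : Nontrivial V := Module.nontrivial_of_finrank_pos (R := L) (hV ▸ hn)
  obtain ⟨u, s, e, hs, hli, hTu⟩ := exists_linearIndependent_iterate hd hτ T
    (T.injective_of_span_range_eq_top hT)
  obtain ⟨s, rfl⟩ := Nat.exists_eq_succ_of_ne_zero hs
  let w (i : Fin (s + 1)) : V := T^[i] u
  let N := Submodule.span L (Set.range w)
  let bN : Module.Basis (Fin (s + 1)) L N := Module.Basis.span hli
  have hbN (i) : (bN i : V) = w i :=
    congrArg Subtype.val (Module.Basis.span_apply hli i)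
  let A : Matrix (Fin (s + 1)) (Fin (s + 1)) L := Matrix.of fun i j ↦
    if j = Fin.last s then if i = 0 then (p : L) ^ e else 0 else if i = j + 1 then 1 else 0
  have hAσ : A.map σ = A := by
    ext i j
    simp only [A, Matrix.map_apply, Matrix.of_apply]
    split_ifs <;> simp
  have hA (j) : T (w j) = ∑ i, A i j • w i := by
    have hTw : T (w j) = T^[j + 1] u := (Function.iterate_succ_apply' _ _ _).symm
    rw [hTw]
    induction j using Fin.lastCases with
    | last => simp [A, w, hTu]
    | cast j => simp [A, w, Fin.castSucc_ne_last, Fin.coeSucc_eq_succ]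
  have hTN (x : V) (hx : x ∈ N) : T x ∈ N := by
    obtain ⟨c, rfl⟩ := (Submodule.mem_span_range_iff_exists_fun L).mp hx
    rw [map_sum]
    refine Submodule.sum_mem _ fun j _ ↦ ?_
    rw [LinearMap.map_smulₛₗ, hA]
    exact Submodule.smul_mem _ _ <| Submodule.sum_mem _ fun i _ ↦
      Submodule.smul_mem _ _ (Submodule.subset_span ⟨i, rfl⟩)
  let TQ : (V ⧸ N) →ₛₗ[τ] (V ⧸ N) := N.mapQ N T hTN
  have hTQ : Submodule.span L (Set.range TQ) = ⊤ := by
    have : Set.range TQ = N.mkQ '' Set.range T := by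
      ext y
      constructor
      · rintro ⟨x, rfl⟩
        obtain ⟨x, rfl⟩ := N.mkQ_surjective x
        exact ⟨T x, ⟨x, rfl⟩, rfl⟩
      · rintro ⟨_, ⟨x, rfl⟩, rfl⟩
        exact ⟨N.mkQ x, rfl⟩
    rw [this, ← Submodule.map_span, hT, Submodule.map_top, Submodule.range_mkQ]
  have hNrank : Module.finrank L N = s + 1 := by simp [Module.finrank_eq_card_basis bN]
  have hrank := N.finrank_quotient_add_finrank
  obtain ⟨κ, _, c, D, hDσ, hD⟩ := ih (Module.finrank L (V ⧸ N)) (by omega) rfl TQ hTQ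
  obtain ⟨E, hE⟩ := exists_mul_eq_one_of_span_range_eq_top c TQ hTQ D hD
  choose v hv using fun j ↦ N.mkQ_surjective (c j)
  have hx (j : κ) : T (v j) - ∑ i, D i j • v i ∈ N := by
    rw [← N.ker_mkQ, LinearMap.mem_ker, map_sub, map_sum]
    simp only [map_smul, hv]
    rw [← hD, ← hv, sub_eq_zero]
    rfl
  let x (j : κ) : N := ⟨_, hx j⟩
  let TN : N →ₛₗ[τ] N := T.restrict hTN
  let S : (κ → N) →ₛₗ[τ] (κ → N) :=
    { toFun := fun z l ↦ ∑ j, E j l • TN (z j)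
      map_add' := fun y z ↦ by
        ext l
        simp [sum_add_distrib]
      map_smul' := fun a z ↦ by
        ext l
        simp [smul_sum, smul_comm (τ a)] }
  obtain ⟨z, hz⟩ := exists_semilinear_add_eq S (twistedEval_surjective_of_fractionRing hd hτ)
    fun l ↦ ∑ j, E j l • x j
  have hz' (j : κ) : ∑ i, D i j • z i = TN (z j) + x j := by
    have h1 (i : κ) : z i = ∑ l, E l i • (TN (z l) + x l) := by
      conv_lhs => rw [← hz]
      simp [S, sum_add_distrib]
    calc ∑ i, D i j • z i = ∑ l, (∑ i, E l i * D i j) • (TN (z l) + x l) := by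
          simp_rw [sum_smul]
          rw [sum_comm]
          refine sum_congr rfl fun i _ ↦ ?_
          rw [h1 i, smul_sum]
          simp_rw [smul_smul, mul_comm]
      _ = _ := by
          simp_rw [← Matrix.mul_apply, hE]
          simp [Matrix.one_apply, sum_add_distrib]
  have hli' : LinearIndependent L (Sum.elim (fun i ↦ (bN i : V)) fun j ↦ v j + z j) := by
    refine bN.linearIndependent.sumElim_of_quotient _ ?_
    have h : (N.mkQ ∘ fun j ↦ v j + (z j : V)) = c := by
      ext j
      rw [Function.comp_apply, map_add, hv]
      simp
    convert! c.linearIndependent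
  let b := basisOfLinearIndependentOfCardEqFinrank hli' (by
    rw [Fintype.card_sum, Fintype.card_fin, ← Module.finrank_eq_card_basis c]
    omega)
  refine ⟨Fin (s + 1) ⊕ κ, inferInstance, b, Matrix.fromBlocks A 0 0 D, ?_, ?_⟩
  · rw [Matrix.fromBlocks_map, hAσ, hDσ]
    simp
  · have hb1 (i) : b (.inl i) = w i := by simp [b, hbN]
    have hb2 (j) : b (.inr j) = v j + z j := by simp [b]
    rintro (j | j)
    · simp [hb1, hA]
    · have h := congrArg (Subtype.val : N → V) (hz' j)
      simp only [x, TN, Submodule.coe_add, Submodule.coe_sum, Submodule.coe_smul] at h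
      simp only [Fintype.sum_sum_type, hb2, Matrix.fromBlocks_apply₁₂, Matrix.fromBlocks_apply₂₂,
        Matrix.zero_apply, zero_smul, sum_const_zero, zero_add, map_add, smul_add, sum_add_distrib,
        h]
      simp
      abel

end WittVector

end StableBasis

namespace WittVector

/-- Every `τ`-conjugacy class of invertible matrices contains a matrix fixed by `σ`. -/
theorem exists_isUnit_mul_map_eq_mul_fixed {p : ℕ} [Fact p.Prime] {k : Type*} [Field k] [CharP k p]
    [PerfectRing k p] [IsAlgClosed k] {L : Type*} [Field L] [Algebra (WittVector p k) L]
    [IsFractionRing (WittVector p k) L] {d : ℕ} (hd : d ≠ 0) {τ : L →+* L}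
    (hτ : ∀ x, τ (algebraMap (WittVector p k) L x) =
      algebraMap _ L ((frobeniusLift p k d).frob x)) (σ : L →+* L) {n : ℕ}
    (g : Matrix (Fin n) (Fin n) L) (hg : IsUnit g) :
    ∃ h g₀ : Matrix (Fin n) (Fin n) L, IsUnit h ∧ g₀.map σ = g₀ ∧ g * h.map τ = h * g₀ := by
  classical
  let T : (Fin n → L) →ₛₗ[τ] (Fin n → L) :=
    { toFun := fun x ↦ g.mulVec (τ ∘ x)
      map_add' := fun x y ↦ by
        rw [← Matrix.mulVec_add]
        congr 1
        ext i
        simp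
      map_smul' := fun a x ↦ by
        rw [← Matrix.mulVec_smul]
        congr 1
        ext i
        simp }
  have hT : Submodule.span L (Set.range T) = ⊤ := by
    rw [eq_top_iff]
    intro y _
    obtain ⟨x, rfl⟩ := Matrix.mulVec_surjective_iff_isUnit.mpr hg y
    rw [pi_eq_sum_univ' x, Matrix.mulVec_sum]
    refine Submodule.sum_mem _ fun i _ ↦ ?_
    rw [Matrix.mulVec_smul]
    refine Submodule.smul_mem _ _ (Submodule.subset_span ⟨Pi.single i 1, ?_⟩)
    change g.mulVec _ = g.mulVec _
    congr 1
    ext j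
    simp [Pi.single_apply, apply_ite τ, eq_comm]
  obtain ⟨ι, _, b, A, hA, hb⟩ := exists_basis_fixed_matrix hd hτ σ n (by simp) T hT
  let e : ι ≃ Fin n := Fintype.equivOfCardEq (by
    rw [← Module.finrank_eq_card_basis b]
    simp)
  let b' := b.reindex e
  refine ⟨(Pi.basisFun L (Fin n)).toMatrix b', A.submatrix e.symm e.symm, ?_, ?_, ?_⟩
  · exact IsUnit.of_mul_eq_one _ ((Pi.basisFun L (Fin n)).toMatrix_mul_toMatrix_flip b')
  · rw [← Matrix.submatrix_map, hA]
  · ext i j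
    have h := congrFun (hb (e.symm j)) i
    simp only [T, LinearMap.coe_mk, AddHom.coe_mk, Matrix.mulVec, dotProduct, Function.comp_apply,
      Finset.sum_apply, Pi.smul_apply, smul_eq_mul] at h
    simp only [Matrix.mul_apply, Matrix.map_apply, Module.Basis.toMatrix_apply, b',
      Pi.basisFun_repr, Module.Basis.reindex_apply, Matrix.submatrix_apply, h]
    rw [← e.symm.sum_comp]
    exact sum_congr rfl fun _ _ ↦ mul_comm _ _

end WittVector

end FrobeniusConjugacy

/-- Let `k` be an algebraically closed field of characteristic `p`, `L` the fraction field of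
the Witt vectors `W(k)`, and `σ : L ≃+* L` the automorphism induced by the Witt vector
Frobenius. Then every `g ∈ GL_n(L)` is `σ^d`-conjugate to `σ(g)`: there is an invertible
matrix `h` with `σ(g) = h · g · σ^d(h)⁻¹`. -/
theorem sigma_pow_d_conjugate_to_sigma
    (p : ℕ) [Fact p.Prime] (k : Type) [Field k] [CharP k p] [IsAlgClosed k]
    (L : Type) [Field L] [Algebra (WittVector p k) L] [IsFractionRing (WittVector p k) L]
    (σ : L ≃+* L)
    (hσ : ∀ x : WittVector p k,
      σ (algebraMap (WittVector p k) L x) =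
        algebraMap (WittVector p k) L (WittVector.frobenius x))
    (n d : ℕ) (hn : 1 ≤ n) (hd : 1 ≤ d)
    (g : Matrix (Fin n) (Fin n) L) (hg : IsUnit g) :
    ∃ h : Matrix (Fin n) (Fin n) L, IsUnit h ∧
      g.map ⇑σ = h * g * (h.map ((⇑σ)^[d]))⁻¹ := by
  let S : L →+* L := σ
  have hτ (x : WittVector p k) : (S ^ d) (algebraMap (WittVector p k) L x) =
      algebraMap _ L ((WittVector.frobeniusLift p k d).frob x) := by
    change (S ^ d) _ = algebraMap _ L ((WittVector.frobenius ^ d) x)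
    clear hd
    induction d with
    | zero => rfl
    | succ d ih =>
      rw [pow_succ', pow_succ', RingHom.mul_def, RingHom.mul_def, RingHom.comp_apply,
        RingHom.comp_apply, ih]
      exact hσ _
  obtain ⟨h, g₀, hh, hg₀, hgh⟩ :=
    WittVector.exists_isUnit_mul_map_eq_mul_fixed (by omega) hτ S g hg
  have hpow : ⇑(S ^ d) = σ^[d] := RingHom.coe_pow S d
  have hmul (f : L →+* L) (a b : Matrix (Fin n) (Fin n) L) : (a * b).map f = a.map f * b.map f :=
    Matrix.map_mul
  have hunit (f : L →+* L) {a : Matrix (Fin n) (Fin n) L} (ha : IsUnit a) : IsUnit (a.map f) :=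
    ha.map f.mapMatrix
  have hdet {a : Matrix (Fin n) (Fin n) L} (ha : IsUnit a) : IsUnit a.det :=
    (Matrix.isUnit_iff_isUnit_det a).mp ha
  have hinv : IsUnit h⁻¹ := (Matrix.isUnit_nonsing_inv_iff).mpr hh
  refine ⟨h.map S * h⁻¹, (hunit S hh).mul hinv, ?_⟩
  rw [← hpow]
  have key : g.map S * (h.map S * h⁻¹).map (S ^ d) = h.map S * h⁻¹ * g := by
    have hcomm : (h.map S).map (S ^ d) = (h.map (S ^ d)).map S := by
      ext i j
      exact congrArg (fun f : L →+* L ↦ f (h i j)) ((pow_succ S d).symm.trans (pow_succ' S d))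
    have hg' : h⁻¹ * g = g₀ * h⁻¹.map (S ^ d) := by
      calc h⁻¹ * g = h⁻¹ * (g * (h * h⁻¹).map (S ^ d)) := by
            rw [Matrix.mul_nonsing_inv _ (hdet hh), Matrix.map_one _ (map_zero _) (map_one _),
              mul_one]
        _ = h⁻¹ * (h * g₀ * h⁻¹.map (S ^ d)) := by rw [hmul, ← mul_assoc g, hgh]
        _ = g₀ * h⁻¹.map (S ^ d) := by
            rw [mul_assoc h, Matrix.nonsing_inv_mul_cancel_left _ _ (hdet hh)]
    rw [hmul (S ^ d), hcomm, ← mul_assoc, ← hmul, hgh, hmul, hg₀, mul_assoc, ← hg', mul_assoc]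
  rw [← key, Matrix.mul_nonsing_inv_cancel_right _ _ (hdet (hunit _ ((hunit S hh).mul hinv)))]
  rfl
end
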